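/- arXiv:2408.03527 — 3 statements merged into one kernel-verified Lean document; each statement's English description precedes it below -/
import Mathlib

section
/- Let a, b ∈ ℝ^m lie in the same open face of the derived arrangement δA_o, and let I, J, K be any partition of {1,…,m}. Then P(a,I,J,K) and P(b,I,J,K) are combinatorially equivalent: there exists a bijection Φ from the set of faces of P(a,I,J,K) onto the set of faces of P(b,I,J,K) such that for all faces F, G of P(a,I,J,K), F ⊆ G if and only if Φ(F) ⊆ Φ(G). -/
open RealInnerProductSpace

noncomputable section

/-- `ℝ^n` with the Euclidean inner product. -/
abbrev Euc (n : ℕ) := EuclideanSpace ℝ (Fin n)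

/-- Standard scalar product on `ℝ^m` (as tuples). -/
def dotm {m : ℕ} (c a : Fin m → ℝ) : ℝ := ∑ i, c i * a i

/-- `C` is a circuit: the family `{u i : i ∈ C}` is linearly dependent but every proper
subfamily is linearly independent. -/
def IsCircuit {n m : ℕ} (u : Fin m → Euc n) (C : Set (Fin m)) : Prop :=
  ¬ LinearIndependent ℝ (fun i : C => u i) ∧
    ∀ D : Set (Fin m), D ⊂ C → LinearIndependent ℝ (fun i : D => u i)

/-- `c` is a circuit vector: `∑ i, c i • u i = 0` and the support of `c` is a circuit. -/
def IsCircuitVector {n m : ℕ} (u : Fin m → Euc n) (c : Fin m → ℝ) : Prop :=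
  (∑ i, c i • u i) = 0 ∧ IsCircuit u {i | c i ≠ 0}

/-- `a` and `b` lie in the same open face of the derived arrangement `δA_o`:
for every circuit vector `c`, `⟨c,a⟩` and `⟨c,b⟩` have the same sign. -/
def SameOpenFace {n m : ℕ} (u : Fin m → Euc n) (a b : Fin m → ℝ) : Prop :=
  ∀ c : Fin m → ℝ, IsCircuitVector u c →
    SignType.sign (dotm c a) = SignType.sign (dotm c b)

/-- `I, J, K` is a partition of `{1,…,m}` into pairwise disjoint (possibly empty) sets. -/
def IsTripartition {m : ℕ} (I J K : Set (Fin m)) : Prop :=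
  I ∪ J ∪ K = Set.univ ∧ Disjoint I J ∧ Disjoint I K ∧ Disjoint J K

/-- The convex polyhedron `P(a,I,J,K)`. -/
def poly {n m : ℕ} (u : Fin m → Euc n) (a : Fin m → ℝ) (I J K : Set (Fin m)) :
    Set (Euc n) :=
  {x | (∀ i ∈ I, ⟪u i, x⟫ = a i) ∧ (∀ j ∈ J, ⟪u j, x⟫ ≤ a j) ∧ (∀ k ∈ K, a k ≤ ⟪u k, x⟫)}

/-- The normal cone of `P` at `x`. -/
def normalCone {n : ℕ} (P : Set (Euc n)) (x : Euc n) : Set (Euc n) :=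
  {v | ∀ y ∈ P, ⟪v, y⟫ ≤ ⟪v, x⟫}

/-- The normal fan of `P`: the family of normal cones at points of `P`. -/
def normalFan {n : ℕ} (P : Set (Euc n)) : Set (Set (Euc n)) :=
  {N | ∃ x ∈ P, N = normalCone P x}

/-- A face of a convex polyhedron: the empty set or an exposed face. -/
def IsFace {n : ℕ} (P F : Set (Euc n)) : Prop :=
  F = ∅ ∨ ∃ v : Euc n, F = {x ∈ P | ∀ y ∈ P, ⟪v, y⟫ ≤ ⟪v, x⟫}

/-- The set of sign vectors of the parallel translation `A_a`. -/
def signSet {n m : ℕ} (u : Fin m → Euc n) (a : Fin m → ℝ) : Set (Fin m → SignType) :=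
  {s | ∃ x : Euc n, ∀ i, s i = SignType.sign (⟪u i, x⟫ - a i)}

/-- `d` is conformal to `c`. -/
def Conf {m : ℕ} (d c : Fin m → ℝ) : Prop :=
  ∀ i, 0 ≤ d i * c i ∧ (c i = 0 → d i = 0)

/-- Support as a finset. -/
def fsupp {m : ℕ} (c : Fin m → ℝ) : Finset (Fin m) := Finset.univ.filter (fun i => c i ≠ 0)

lemma mem_fsupp {m : ℕ} (c : Fin m → ℝ) (i : Fin m) : i ∈ fsupp c ↔ c i ≠ 0 := by
  simp [fsupp]

lemma Conf.trans' {m : ℕ} {d e c : Fin m → ℝ} (h1 : Conf d e) (h2 : Conf e c) : Conf d c := by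
  intro i
  obtain ⟨p1, q1⟩ := h1 i
  obtain ⟨p2, q2⟩ := h2 i
  refine ⟨?_, fun h => q1 (q2 h)⟩
  by_cases he : e i = 0
  · rw [q1 he]; simp
  · have h3 : 0 < e i ^ 2 := by positivity
    have h4 : 0 ≤ (d i * c i) * e i ^ 2 := by
      have := mul_nonneg p1 p2
      nlinarith
    exact nonneg_of_mul_nonneg_left h4 h3

lemma reduce_step {m : ℕ} (d e : Fin m → ℝ) (hsub : ∀ i, d i = 0 → e i = 0)
    (hpos : ∃ i, 0 < e i * d i) :
    ∃ l : ℝ, 0 < l ∧ Conf (fun i => d i - l * e i) d ∧ ∃ i, d i ≠ 0 ∧ d i - l * e i = 0 := by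
  classical
  let T : Finset (Fin m) := Finset.univ.filter (fun i => 0 < e i * d i)
  have hT : T.Nonempty := by
    obtain ⟨i, hi⟩ := hpos
    exact ⟨i, by simp [T, hi]⟩
  obtain ⟨k, hk, hmin⟩ := Finset.exists_min_image T (fun i => d i / e i) hT
  have hk' : 0 < e k * d k := by simpa [T] using hk
  have hek : e k ≠ 0 := by rintro h; simp [h] at hk'
  have hdk : d k ≠ 0 := by rintro h; simp [h] at hk'
  have hl : 0 < d k / e k := by
    have : d k / e k = (e k * d k) / (e k ^ 2) := by field_simp
    rw [this]; positivity
  refine ⟨d k / e k, hl, ?_, k, hdk, by field_simp; ring⟩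
  intro i
  refine ⟨?_, fun h => by simp [h, hsub i h]⟩
  by_cases hi : 0 < e i * d i
  · have h1 := hmin i (by simp [T, hi])
    have hei : e i ≠ 0 := by rintro h; simp [h] at hi
    have h2 : d k / e k * (e i * d i) ≤ d i / e i * (e i * d i) :=
      mul_le_mul_of_nonneg_right h1 hi.le
    have h3 : d i / e i * (e i * d i) = d i * d i := by field_simp
    simp only
    nlinarith
  · push Not at hi
    have := mul_nonneg hl.le (neg_nonneg.2 hi)
    simp only
    nlinarith [mul_self_nonneg (d i)]

lemma card_lt_of_conf {m : ℕ} {d c : Fin m → ℝ} (h : Conf d c) {i : Fin m} (hi : c i ≠ 0)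
    (hd : d i = 0) : (fsupp d).card < (fsupp c).card := by
  apply Finset.card_lt_card
  rw [Finset.ssubset_iff_of_subset]
  · exact ⟨i, (mem_fsupp _ _).2 hi, by simp [mem_fsupp, hd]⟩
  · intro j hj
    rw [mem_fsupp] at hj ⊢
    exact fun h' => hj ((h j).2 h')

lemma dep_ext {n m : ℕ} (u : Fin m → Euc n) (D : Set (Fin m))
    (h : ¬ LinearIndependent ℝ (fun i : D => u i)) :
    ∃ e : Fin m → ℝ, (∑ i, e i • u i) = 0 ∧ (∃ i, e i ≠ 0) ∧ ∀ i, i ∉ D → e i = 0 := by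
  classical
  rw [Fintype.not_linearIndependent_iff] at h
  obtain ⟨g, hg, i, hi⟩ := h
  refine ⟨fun j => if hj : j ∈ D then g ⟨j, hj⟩ else 0, ?_, ⟨i, by simpa using hi⟩, ?_⟩
  · rw [← hg]
    rw [← Finset.sum_subset (Finset.subset_univ (Finset.univ.filter (· ∈ D)))]
    · rw [← Finset.sum_subtype_of_mem (p := (· ∈ D)) (s := Finset.univ.filter (· ∈ D))
        (fun j => (if hj : j ∈ D then g ⟨j, hj⟩ else 0) • u j) (by simp)]
      apply Finset.sum_congr
      · ext; simp
      · intro x _; simp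
    · intro x _ hx
      simp at hx
      simp [hx]
  · intro j hj; simp [hj]

lemma exists_circuit {n m : ℕ} (u : Fin m → Euc n) (N : ℕ) :
    ∀ c : Fin m → ℝ, (fsupp c).card ≤ N → (∑ i, c i • u i) = 0 → (∃ i, c i ≠ 0) →
    ∃ d : Fin m → ℝ, IsCircuitVector u d ∧ Conf d c ∧ ∃ i, d i ≠ 0 := by
  induction N with
  | zero =>
    intro c hc _ ⟨i, hi⟩
    have : fsupp c = ∅ := by simpa using hc
    have h2 := (mem_fsupp c i).2 hi
    simp [this] at h2
  | succ N ih =>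
    intro c hc hker hne
    by_cases hcirc : IsCircuit u {i | c i ≠ 0}
    · exact ⟨c, ⟨hker, hcirc⟩, fun i => ⟨mul_self_nonneg _, id⟩, hne⟩
    have hdep : ¬ LinearIndependent ℝ (fun i : {i | c i ≠ 0} => u i) := by
      classical
      rw [Fintype.not_linearIndependent_iff]
      obtain ⟨i, hi⟩ := hne
      refine ⟨fun j => c j, ?_, ⟨i, hi⟩, hi⟩
      rw [← hker, ← Finset.sum_subset (Finset.subset_univ (Finset.univ.filter (fun i => c i ≠ 0)))]
      · rw [← Finset.sum_subtype_of_mem (p := (fun i => c i ≠ 0))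
          (s := Finset.univ.filter (fun i => c i ≠ 0)) (fun j => c j • u j) (by simp)]
        apply Finset.sum_congr
        · ext x; simp only [Finset.mem_subtype, Finset.mem_filter, Finset.mem_univ, true_and, true_iff, iff_true]; exact x.2
        · intro x _; simp
      · intro x _ hx
        simp at hx
        simp [hx]
    have : ∃ D : Set (Fin m), D ⊂ {i | c i ≠ 0} ∧ ¬ LinearIndependent ℝ (fun i : D => u i) := by
      by_contra hcon
      push Not at hcon
      exact hcirc ⟨hdep, hcon⟩
    obtain ⟨D, hD, hDdep⟩ := this
    obtain ⟨e, he, ⟨k, hk⟩, hout⟩ := dep_ext u D hDdep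
    have hsub : ∀ i, c i = 0 → e i = 0 := fun i hi => hout i (fun h => hD.1 h hi)
    obtain ⟨p, hp, hpD⟩ := Set.exists_of_ssubset hD
    have key : ∀ e : Fin m → ℝ, (∑ i, e i • u i) = 0 → (∀ i, c i = 0 → e i = 0) → e p = 0 →
        (∃ i, 0 < e i * c i) →
        ∃ d : Fin m → ℝ, IsCircuitVector u d ∧ Conf d c ∧ ∃ i, d i ≠ 0 := by
      intro e he hsub hep hpos
      obtain ⟨l, hl, hconf, i, hi, hi0⟩ := reduce_step c e hsub hpos
      have hlt := card_lt_of_conf hconf hi hi0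
      obtain ⟨d, h1, h2, h3⟩ := ih (fun i => c i - l * e i) (by omega) (by
        simp only [sub_smul, Finset.sum_sub_distrib, hker, mul_smul, ← Finset.smul_sum, he]
        simp) ⟨p, by simpa [hep] using hp⟩
      exact ⟨d, h1, h2.trans' hconf, h3⟩
    have hck : c k ≠ 0 := fun h => hk (hsub k h)
    rcases lt_or_gt_of_ne (mul_ne_zero hk hck) with h | h
    · exact key (fun i => - e i) (by simp [he]) (fun i hi => by simp [hsub i hi])
        (by simp [hout p hpD]) ⟨k, by linarith⟩
    · exact key e he hsub (hout p hpD) ⟨k, h⟩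

lemma dotm_sub_smul {m : ℕ} (c d a : Fin m → ℝ) (l : ℝ) :
    dotm c a = dotm (fun i => c i - l * d i) a + l * dotm d a := by
  simp only [dotm, Finset.mul_sum, ← Finset.sum_add_distrib]
  exact Finset.sum_congr rfl fun i _ => by ring

lemma dotm_nonneg {m : ℕ} (c a : Fin m → ℝ) (h : ∀ i, 0 ≤ c i * a i) : 0 ≤ dotm c a :=
  Finset.sum_nonneg fun i _ => h i

lemma conf_nonneg {m : ℕ} {d c a : Fin m → ℝ} (h : Conf d c) (hc : ∀ i, 0 ≤ c i * a i) (i : Fin m) :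
    0 ≤ d i * a i := by
  by_cases h0 : c i = 0
  · simp [(h i).2 h0]
  · have h1 := mul_nonneg (h i).1 (hc i)
    have h3 : 0 < c i ^ 2 := by positivity
    have h4 : 0 ≤ (d i * a i) * c i ^ 2 := by nlinarith
    exact nonneg_of_mul_nonneg_left h4 h3

lemma cert {n m : ℕ} (u : Fin m → Euc n) (a b : Fin m → ℝ) (hab : SameOpenFace u a b) (N : ℕ) :
    ∀ c : Fin m → ℝ, (fsupp c).card ≤ N → (∑ i, c i • u i) = 0 → (∀ i, 0 ≤ c i * a i) →
    0 ≤ dotm c b ∧ (0 < dotm c a → 0 < dotm c b) := by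
  induction N with
  | zero =>
    intro c hc _ _
    have h0 : fsupp c = ∅ := by simpa using hc
    have : ∀ i, c i = 0 := by
      intro i; by_contra h
      have h2 := (mem_fsupp c i).2 h
      simp [h0] at h2
    simp [dotm, this]
  | succ N ih =>
    intro c hc hker hnn
    by_cases hne : ∃ i, c i ≠ 0
    · obtain ⟨d, hd, hdc, k, hk⟩ := exists_circuit u _ c le_rfl hker hne
      have hck : c k ≠ 0 := fun h => hk ((hdc k).2 h)
      obtain ⟨l, hl, hconf, i, hi, hi0⟩ := reduce_step c d (fun i => (hdc i).2)
        ⟨k, lt_of_le_of_ne (hdc k).1 (mul_ne_zero hk hck).symm⟩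
      have hlt := card_lt_of_conf hconf hi hi0
      obtain ⟨h1, h2⟩ := ih (fun i => c i - l * d i) (by omega) (by
        simp only [sub_smul, Finset.sum_sub_distrib, hker, mul_smul, ← Finset.smul_sum, hd.1]
        simp) (conf_nonneg hconf hnn)
      have hda : 0 ≤ dotm d a := dotm_nonneg _ _ (conf_nonneg hdc hnn)
      have hs := hab d hd
      have hdb : 0 ≤ dotm d b := by
        rw [← sign_nonneg_iff, ← hs, sign_nonneg_iff]; exact hda
      have hdb' : 0 < dotm d a → 0 < dotm d b := by
        intro h
        rw [← sign_eq_one_iff, ← hs, sign_eq_one_iff]; exact h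
      have ea := dotm_sub_smul c d a l
      have eb := dotm_sub_smul c d b l
      have hm := mul_nonneg hl.le hdb
      refine ⟨by linarith, fun hpos => ?_⟩
      by_cases h : 0 < dotm d a
      · have := mul_pos hl (hdb' h)
        linarith
      · have h0 : dotm d a = 0 := le_antisymm (not_lt.1 h) hda
        rw [h0] at ea
        have := h2 (by linarith)
        linarith
    · push Not at hne
      simp [dotm, hne]

lemma dotm_inner {n m : ℕ} (u : Fin m → Euc n) (c : Fin m → ℝ) (hc : (∑ i, c i • u i) = 0)
    (x : Euc n) : ∑ i, c i * ⟪u i, x⟫ = 0 := by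
  have : ⟪∑ i, c i • u i, x⟫ = 0 := by rw [hc]; simp
  rw [sum_inner] at this
  simpa [inner_smul_left] using this

lemma dotm_shift {n m : ℕ} (u : Fin m → Euc n) (c a : Fin m → ℝ) (hc : (∑ i, c i • u i) = 0)
    (x : Euc n) : dotm c (fun i => a i - ⟪u i, x⟫) = dotm c a := by
  simp only [dotm, mul_sub, Finset.sum_sub_distrib, dotm_inner u c hc x, sub_zero]

lemma fun_apply {m : ℕ} (f : (Fin m → ℝ) →ₗ[ℝ] ℝ) (o : Fin m → ℝ) :
    f o = ∑ i, f (Pi.single i 1) * o i := by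
  conv_lhs => rw [pi_eq_sum_univ' o]
  rw [map_sum]
  refine Finset.sum_congr rfl fun i _ => ?_
  rw [map_smul, smul_eq_mul, mul_comm]

lemma feas_eq {n m : ℕ} (u : Fin m → Euc n) (a b : Fin m → ℝ)
    (H : ∀ c : Fin m → ℝ, (∑ i, c i • u i) = 0 → (∀ i, 0 ≤ c i * a i) →
      0 ≤ dotm c b ∧ (0 < dotm c a → 0 < dotm c b)) :
    ∃ y : Euc n, ∀ i, a i = 0 → ⟪u i, y⟫ = b i := by
  classical
  let L : Euc n →ₗ[ℝ] (Fin m → ℝ) :=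
    LinearMap.pi (fun i => if a i = 0 then (innerₛₗ ℝ (u i)) else 0)
  have hL : ∀ y i, L y i = if a i = 0 then ⟪u i, y⟫ else 0 := by
    intro y i
    by_cases h : a i = 0 <;> simp [L, h]
  let b0 : Fin m → ℝ := fun i => if a i = 0 then b i else 0
  by_cases hb : b0 ∈ LinearMap.range L
  · obtain ⟨y, hy⟩ := hb
    refine ⟨y, fun i hi => ?_⟩
    have := congrFun hy i
    simpa [hL, b0, hi] using this
  exfalso
  obtain ⟨f, hf0, hf⟩ := Submodule.exists_le_ker_of_notMem hb
  let c : Fin m → ℝ := fun i => if a i = 0 then f (Pi.single i 1) else 0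
  have hc : (∑ i, c i • u i) = 0 := by
    apply ext_inner_right ℝ
    intro y
    have h1 : f (L y) = 0 := hf ⟨y, rfl⟩
    rw [fun_apply] at h1
    rw [sum_inner, inner_zero_left, ← h1]
    refine Finset.sum_congr rfl fun i _ => ?_
    by_cases h : a i = 0 <;> simp [c, hL, h, inner_smul_left]
  have hcb : dotm c b = f b0 := by
    rw [fun_apply, dotm]
    refine Finset.sum_congr rfl fun i _ => ?_
    by_cases h : a i = 0 <;> simp [c, b0, h]
  have hca : ∀ i, c i * a i = 0 := by
    intro i
    by_cases h : a i = 0 <;> simp [c, h]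
  have h1 := (H c hc (fun i => (hca i).ge)).1
  have h2 := (H (fun i => - c i) (by simp [hc]) (fun i => by simp [hca i])).1
  have h3 : dotm (fun i => - c i) b = - dotm c b := by simp [dotm]
  apply hf0
  linarith

lemma feas {n m : ℕ} (u : Fin m → Euc n) (a b : Fin m → ℝ)
    (H : ∀ c : Fin m → ℝ, (∑ i, c i • u i) = 0 → (∀ i, 0 ≤ c i * a i) →
      0 ≤ dotm c b ∧ (0 < dotm c a → 0 < dotm c b)) :
    ∃ y : Euc n, ∀ i, SignType.sign (b i - ⟪u i, y⟫) = SignType.sign (a i) := by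
  classical
  obtain ⟨y0, hy0⟩ := feas_eq u a b H
  let O : Set (Fin m → ℝ) := {o | ∀ i, a i ≠ 0 → 0 < o i * a i}
  let B : Set (Fin m → ℝ) := {w | ∃ y : Euc n, (∀ i, w i = b i - ⟪u i, y⟫) ∧
    ∀ i, a i = 0 → ⟪u i, y⟫ = b i}
  have hOopen : IsOpen O := by
    have : O = ⋂ i, {o : Fin m → ℝ | a i ≠ 0 → 0 < o i * a i} := by ext; simp [O]
    rw [this]
    apply isOpen_iInter_of_finite
    intro i
    by_cases h : a i = 0
    · simp [h]
    · simp only [ne_eq, h, not_false_eq_true, forall_const]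
      exact isOpen_lt (by fun_prop) (by fun_prop)
  have hOconv : Convex ℝ O := by
    intro x hx y hy s t hs ht hst i hi
    have h1 := hx i hi
    have h2 := hy i hi
    have : (s • x + t • y) i * a i = s * (x i * a i) + t * (y i * a i) := by
      simp; ring
    rw [this]
    rcases hs.eq_or_lt with h | h
    · have : t = 1 := by linarith
      subst this; subst h; simpa using h2
    · have := mul_pos h h1
      have := mul_nonneg ht h2.le
      linarith
  have hBconv : Convex ℝ B := by
    rintro x ⟨y, hy, hy'⟩ x' ⟨z, hz, hz'⟩ s t hs ht hst
    refine ⟨s • y + t • z, fun i => ?_, fun i hi => ?_⟩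
    · simp only [Pi.add_apply, Pi.smul_apply, smul_eq_mul, inner_add_right, inner_smul_right,
        hy i, hz i]
      linear_combination (b i) * hst
    · simp only [inner_add_right, inner_smul_right, hy' i hi, hz' i hi]
      linear_combination (b i) * hst
  by_contra hcon
  have hdisj : Disjoint O B := by
    rw [Set.disjoint_left]
    rintro w hw ⟨y, hy, hy'⟩
    apply hcon
    refine ⟨y, fun i => ?_⟩
    rw [← hy i]
    by_cases h : a i = 0
    · rw [hy i, hy' i h, h]; simp
    · have := hw i h
      rcases lt_or_gt_of_ne h with h' | h'
      · rw [sign_neg h', sign_neg (by nlinarith)]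
      · rw [sign_pos h', sign_pos (by nlinarith)]
  obtain ⟨f, r, hfO, hfB⟩ := geometric_hahn_banach_open hOconv hOopen hBconv hdisj
  let φ : Fin m → ℝ := fun i => f (Pi.single i 1)
  have hf : ∀ o, f o = ∑ i, φ i * o i := fun o => fun_apply f.toLinearMap o
  have hray : ∀ p q : Fin m → ℝ, (∀ t : ℝ, 0 ≤ t → p + t • q ∈ O) → f q ≤ 0 := by
    intro p q h
    by_contra hq
    push Not at hq
    have h0 := hfO _ (h (|r - f p| / f q) (by positivity))
    rw [map_add, map_smul, smul_eq_mul, div_mul_cancel₀ _ hq.ne'] at h0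
    have := le_abs_self (r - f p)
    linarith
  have hφ1 : ∀ i, φ i * a i ≤ 0 := by
    intro i
    have := hray a (Pi.single i (a i)) (by
      intro t ht j hj
      have h1 : 0 < a j * a j := mul_self_pos.2 hj
      by_cases hji : j = i
      · subst hji
        simp only [Pi.add_apply, Pi.smul_apply, Pi.single_eq_same, smul_eq_mul]
        nlinarith
      · simp [hji]; simpa using hj)
    rw [hf, Finset.sum_eq_single i (by intro j _ hj; simp [hj]) (by simp)] at this
    simpa using this
  have hφ0 : ∀ i, a i = 0 → φ i = 0 := by
    intro i hi
    have hs : ∀ δ : ℝ, φ i * δ ≤ 0 := by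
      intro δ
      have := hray a (Pi.single i δ) (by
        intro t ht j hj
        have h1 : 0 < a j * a j := mul_self_pos.2 hj
        have hji : j ≠ i := by rintro rfl; exact hj hi
        simp [hji]; simpa using hj)
      rw [hf, Finset.sum_eq_single i (by intro j _ hj; simp [hj]) (by simp)] at this
      simpa using this
    have h1 := hs 1
    have h2 := hs (-1)
    linarith
  have hB : ∀ y : Euc n, (∀ i, a i = 0 → ⟪u i, y⟫ = b i) → r ≤ ∑ i, φ i * (b i - ⟪u i, y⟫) := by
    intro y hy
    have := hfB (fun i => b i - ⟪u i, y⟫) ⟨y, fun i => rfl, hy⟩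
    rwa [hf] at this
  have hr : 0 ≤ r := by
    by_contra hr
    push Not at hr
    have hO : ∀ t : ℝ, 0 < t → t • a ∈ O := by
      intro t ht j hj
      have h1 : 0 < a j * a j := mul_self_pos.2 hj
      simp only [Pi.smul_apply, smul_eq_mul]
      nlinarith
    by_cases hfa : f a < 0
    · have := hfO _ (hO (r / f a / 2) (by have := div_pos_of_neg_of_neg hr hfa; linarith))
      rw [map_smul, smul_eq_mul] at this
      have h2 : r / f a / 2 * f a = r / 2 := by field_simp [hfa.ne]
      linarith
    · have := hfO _ (hO 1 one_pos)
      rw [one_smul] at this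
      linarith
  -- the functional vanishes on the kernel
  have hN : ∀ z : Euc n, (∀ i, a i = 0 → ⟪u i, z⟫ = 0) → ∑ i, φ i * ⟪u i, z⟫ = 0 := by
    intro z hz
    by_contra hne
    set q := ∑ i, φ i * ⟪u i, z⟫ with hq
    set p := ∑ i, φ i * (b i - ⟪u i, y0⟫) with hp
    have := hB (y0 + ((p - r + 1) / q) • z) (by
      intro i hi
      rw [inner_add_right, inner_smul_right, hz i hi, hy0 i hi]; ring)
    have h2 : ∑ i, φ i * (b i - ⟪u i, y0 + ((p - r + 1) / q) • z⟫) = p - (p - r + 1) / q * q := by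
      rw [hp, hq, Finset.mul_sum, ← Finset.sum_sub_distrib]
      refine Finset.sum_congr rfl fun i _ => ?_
      rw [inner_add_right, inner_smul_right]; ring
    rw [h2, div_mul_cancel₀ _ hne] at this
    linarith
  let Lf : Fin m → (Euc n →ₗ[ℝ] ℝ) := fun i => if a i = 0 then (innerₛₗ ℝ (u i)) else 0
  have hspan : (∑ i, φ i • (innerₛₗ ℝ (u i)) : Euc n →ₗ[ℝ] ℝ) ∈
      Submodule.span ℝ (Set.range Lf) := by
    apply mem_span_of_iInf_ker_le_ker
    intro z hz
    rw [LinearMap.mem_ker]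
    simp only [Submodule.mem_iInf, LinearMap.mem_ker] at hz
    have := hN z (fun i hi => by simpa [Lf, hi] using hz i)
    simpa using this
  rw [Submodule.mem_span_range_iff_exists_fun] at hspan
  obtain ⟨g, hg⟩ := hspan
  let c : Fin m → ℝ := fun i => (if a i = 0 then g i else 0) - φ i
  have hc : (∑ i, c i • u i) = 0 := by
    apply ext_inner_right ℝ
    intro y
    have h1 := LinearMap.congr_fun hg y
    simp only [LinearMap.sum_apply, LinearMap.smul_apply, smul_eq_mul] at h1
    rw [sum_inner, inner_zero_left, ← sub_eq_zero.2 h1, ← Finset.sum_sub_distrib]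
    refine Finset.sum_congr rfl fun i _ => ?_
    by_cases h : a i = 0 <;> simp [c, Lf, h, inner_smul_left] <;> ring
  have hca : ∀ i, c i * a i = - (φ i * a i) := by
    intro i
    by_cases h : a i = 0 <;> simp [c, h]
  obtain ⟨-, h2⟩ := H c hc (fun i => by rw [hca]; linarith [hφ1 i])
  have hcb : dotm c b = - ∑ i, φ i * (b i - ⟪u i, y0⟫) := by
    rw [← dotm_shift u c b hc y0, dotm, ← Finset.sum_neg_distrib]
    refine Finset.sum_congr rfl fun i _ => ?_
    by_cases h : a i = 0
    · simp [hy0 i h]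
    · simp [c, h]
  have hBy := hB y0 hy0
  have hfa : f a < r := hfO a (fun i hi => mul_self_pos.2 hi)
  have hda : dotm c a = - ∑ i, φ i * a i := by
    rw [dotm, ← Finset.sum_neg_distrib]
    exact Finset.sum_congr rfl fun i _ => hca i
  have hnn : 0 ≤ dotm c a := dotm_nonneg _ _ (fun i => by rw [hca]; linarith [hφ1 i])
  rcases hnn.eq_or_lt with h | h
  · have h3 : ∑ i, φ i * a i = 0 := by linarith
    have h4 := (Finset.sum_eq_zero_iff_of_nonpos (fun i _ => hφ1 i)).1 h3
    have h5 : ∀ i, φ i = 0 := by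
      intro i
      by_cases hi : a i = 0
      · exact hφ0 i hi
      · exact (mul_eq_zero.1 (h4 i (Finset.mem_univ i))).resolve_right hi
    rw [hf, h3] at hfa
    simp [h5] at hBy
    linarith
  · have := h2 h
    linarith

/-- Sign vector of `x` in the translated arrangement. -/
def sg {n m : ℕ} (u : Fin m → Euc n) (a : Fin m → ℝ) (x : Euc n) : Fin m → SignType :=
  fun i => SignType.sign (a i - ⟪u i, x⟫)

lemma exists_sg {n m : ℕ} (u : Fin m → Euc n) (a b : Fin m → ℝ) (hab : SameOpenFace u a b)
    (x : Euc n) : ∃ y, sg u b y = sg u a x := by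
  have h' : SameOpenFace u (fun i => a i - ⟪u i, x⟫) b := by
    intro c hc
    rw [dotm_shift u c a hc.1 x]
    exact hab c hc
  obtain ⟨y, hy⟩ := feas u _ b (fun c hc hn => cert u _ b h' _ c le_rfl hc hn)
  exact ⟨y, funext hy⟩

lemma sg_zero {n m : ℕ} {u : Fin m → Euc n} {a : Fin m → ℝ} {x : Euc n} {i : Fin m} :
    sg u a x i = 0 ↔ ⟪u i, x⟫ = a i := by
  rw [sg, sign_eq_zero_iff, sub_eq_zero, eq_comm]

lemma mem_poly_iff {n m : ℕ} {u : Fin m → Euc n} {a : Fin m → ℝ} {I J K : Set (Fin m)}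
    {x : Euc n} : x ∈ poly u a I J K ↔ (∀ i ∈ I, sg u a x i = 0) ∧ (∀ j ∈ J, 0 ≤ sg u a x j) ∧
      ∀ k ∈ K, sg u a x k ≤ 0 := by
  simp only [sg_zero]
  simp [poly, sg, sign_nonneg_iff, sign_nonpos_iff]

/-- Faces given by tight sets. -/
def tface {n m : ℕ} (u : Fin m → Euc n) (a : Fin m → ℝ) (I J K : Set (Fin m)) (x : Euc n) :
    Set (Euc n) :=
  {y ∈ poly u a I J K | ∀ i, sg u a x i = 0 → sg u a y i = 0}

lemma tface_isFace {n m : ℕ} (u : Fin m → Euc n) (a : Fin m → ℝ) {I J K : Set (Fin m)}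
    (hT : IsTripartition I J K) {x : Euc n} (hx : x ∈ poly u a I J K) :
    IsFace (poly u a I J K) (tface u a I J K x) := by
  classical
  right
  let ε : Fin m → ℝ := fun i => if sg u a x i = 0 then
    (if i ∈ J then 1 else if i ∈ K then -1 else 0) else 0
  have hle : ∀ y ∈ poly u a I J K, ∀ i, ε i * ⟪u i, y⟫ ≤ ε i * a i := by
    intro y hy i
    by_cases h0 : sg u a x i = 0
    · by_cases hJ : i ∈ J
      · simpa [ε, h0, hJ] using hy.2.1 i hJ
      · by_cases hK : i ∈ K
        · simpa [ε, h0, hJ, hK] using hy.2.2 i hK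
        · simp [ε, hJ, hK]
    · simp [ε, h0]
  have hv : ∀ y, ⟪∑ i, ε i • u i, y⟫ = ∑ i, ε i * ⟪u i, y⟫ := by
    intro y; rw [sum_inner]; simp [inner_smul_left]
  have hxe : ∑ i, ε i * ⟪u i, x⟫ = ∑ i, ε i * a i := by
    refine Finset.sum_congr rfl fun i _ => ?_
    by_cases h0 : sg u a x i = 0
    · rw [sg_zero.1 h0]
    · simp [ε, h0]
  refine ⟨∑ i, ε i • u i, ?_⟩
  ext y
  simp only [tface, Set.mem_ofPred_eq, hv]
  refine and_congr_right fun hy => ⟨fun h z hz => ?_, fun h i hi => ?_⟩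
  · have : ∑ i, ε i * ⟪u i, y⟫ = ∑ i, ε i * a i := by
      refine Finset.sum_congr rfl fun i _ => ?_
      by_cases h0 : sg u a x i = 0
      · rw [sg_zero.1 (h i h0)]
      · simp [ε, h0]
    rw [this]
    exact Finset.sum_le_sum fun i _ => hle z hz i
  · have h1 := h x hx
    rw [hxe] at h1
    have h2 := (Finset.sum_eq_sum_iff_of_le (fun i _ => hle y hy i)).1
      (le_antisymm (Finset.sum_le_sum fun i _ => hle y hy i) h1) i (Finset.mem_univ i)
    rw [sg_zero]
    have hu : i ∈ I ∪ J ∪ K := by rw [hT.1]; trivial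
    rcases hu with (hI | hJ) | hK
    · exact hy.1 i hI
    · simpa [ε, hi, hJ] using h2
    · have : i ∉ J := fun hJ => Set.disjoint_left.1 hT.2.2.2 hJ hK
      simpa [ε, hi, hK, this] using h2

lemma poly_convex {n m : ℕ} (u : Fin m → Euc n) (a : Fin m → ℝ) (I J K : Set (Fin m))
    {x y : Euc n} (hx : x ∈ poly u a I J K) (hy : y ∈ poly u a I J K) :
    (1/2 : ℝ) • x + (1/2 : ℝ) • y ∈ poly u a I J K := by
  refine ⟨fun i hi => ?_, fun i hi => ?_, fun i hi => ?_⟩ <;>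
    simp only [inner_add_right, inner_smul_right]
  · rw [hx.1 i hi, hy.1 i hi]; ring
  · linarith [hx.2.1 i hi, hy.2.1 i hi]
  · linarith [hx.2.2 i hi, hy.2.2 i hi]

lemma mid_zero {n m : ℕ} {u : Fin m → Euc n} {a : Fin m → ℝ} {I J K : Set (Fin m)}
    (hT : IsTripartition I J K)
    {x y : Euc n} (hx : x ∈ poly u a I J K) (hy : y ∈ poly u a I J K) {i : Fin m}
    (h : sg u a ((1/2 : ℝ) • x + (1/2 : ℝ) • y) i = 0) : sg u a x i = 0 ∧ sg u a y i = 0 := by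
  simp only [sg_zero, inner_add_right, inner_smul_right] at *
  have hu : i ∈ I ∪ J ∪ K := by rw [hT.1]; trivial
  rcases hu with (hI | hJ) | hK
  · exact ⟨hx.1 i hI, hy.1 i hI⟩
  · constructor <;> linarith [hx.2.1 i hJ, hy.2.1 i hJ]
  · constructor <;> linarith [hx.2.2 i hK, hy.2.2 i hK]

lemma extend_back {n m : ℕ} {u : Fin m → Euc n} {a : Fin m → ℝ} {I J K : Set (Fin m)}
    {x y : Euc n} (hx : x ∈ poly u a I J K)
    (hy : y ∈ tface u a I J K x) :
    ∃ t : ℝ, 0 < t ∧ x + t • (x - y) ∈ poly u a I J K := by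
  have key : ∀ i, ∀ᶠ t : ℝ in nhdsWithin 0 (Set.Ioi 0),
      (i ∈ I → ⟪u i, x + t • (x - y)⟫ = a i) ∧ (i ∈ J → ⟪u i, x + t • (x - y)⟫ ≤ a i) ∧
      (i ∈ K → a i ≤ ⟪u i, x + t • (x - y)⟫) := by
    intro i
    by_cases h0 : sg u a x i = 0
    · have h1 := sg_zero.1 h0
      have h2 := sg_zero.1 (hy.2 i h0)
      refine Filter.Eventually.of_forall fun t => ?_
      have : ⟪u i, x + t • (x - y)⟫ = a i := by
        rw [inner_add_right, inner_smul_right, inner_sub_right, h1, h2]; ring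
      simp [this]
    · have hne : ⟪u i, x⟫ ≠ a i := fun h => h0 (sg_zero.2 h)
      have hcont : Filter.Tendsto (fun t : ℝ => ⟪u i, x + t • (x - y)⟫)
          (nhdsWithin 0 (Set.Ioi 0)) (nhds ⟪u i, x⟫) := by
        have : Continuous (fun t : ℝ => ⟪u i, x + t • (x - y)⟫) := by fun_prop
        have h := this.tendsto 0
        simp only [zero_smul, add_zero] at h
        exact h.mono_left nhdsWithin_le_nhds
      rcases lt_or_gt_of_ne hne with hlt | hgt
      · filter_upwards [hcont.eventually_lt_const hlt] with t ht
        refine ⟨fun h => absurd (hx.1 i h) hne, fun _ => ht.le, fun h => ?_⟩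
        exact absurd (hx.2.2 i h) (not_le.2 hlt)
      · filter_upwards [hcont.eventually_const_lt hgt] with t ht
        refine ⟨fun h => absurd (hx.1 i h) hne, fun h => ?_, fun _ => ht.le⟩
        exact absurd (hx.2.1 i h) (not_le.2 hgt)
  have h2 := (Filter.eventually_all.2 key).and self_mem_nhdsWithin
  obtain ⟨t, ht, ht0⟩ := h2.exists
  exact ⟨t, ht0, fun i hi => (ht i).1 hi, fun i hi => (ht i).2.1 hi, fun i hi => (ht i).2.2 hi⟩

lemma face_eq_tface {n m : ℕ} (u : Fin m → Euc n) (a : Fin m → ℝ) {I J K : Set (Fin m)}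
    (hT : IsTripartition I J K) {F : Set (Euc n)} (hF : IsFace (poly u a I J K) F) :
    F = ∅ ∨ ∃ x ∈ poly u a I J K, F = tface u a I J K x := by
  classical
  rcases hF with h | ⟨v, rfl⟩
  · exact Or.inl h
  set F : Set (Euc n) := {x ∈ poly u a I J K | ∀ y ∈ poly u a I J K, ⟪v, y⟫ ≤ ⟪v, x⟫} with hFdef
  rcases F.eq_empty_or_nonempty with h | hne
  · exact Or.inl h
  right
  let card : Euc n → ℕ := fun x => (Finset.univ.filter (fun i => sg u a x i = 0)).card
  obtain ⟨x, hxF, hmin⟩ : ∃ x ∈ F, ∀ y ∈ F, card x ≤ card y := by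
    have hne' : (card '' F).Nonempty := hne.image _
    obtain ⟨x, hx, hxe⟩ := Nat.sInf_mem hne'
    exact ⟨x, hx, fun y hy => by rw [hxe]; exact Nat.sInf_le ⟨y, hy, rfl⟩⟩
  refine ⟨x, hxF.1, ?_⟩
  ext y
  constructor
  · intro hy
    refine ⟨hy.1, ?_⟩
    have hmid : (1/2 : ℝ) • x + (1/2 : ℝ) • y ∈ F := by
      refine ⟨poly_convex u a I J K hxF.1 hy.1, fun z hz => ?_⟩
      simp only [inner_add_right, inner_smul_right]
      linarith [hxF.2 z hz, hy.2 z hz]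
    have hsub : (Finset.univ.filter (fun i => sg u a ((1/2 : ℝ) • x + (1/2 : ℝ) • y) i = 0)) ⊆
        (Finset.univ.filter (fun i => sg u a x i = 0)) := by
      intro i hi
      simp only [Finset.mem_filter, Finset.mem_univ, true_and] at hi ⊢
      exact (mid_zero hT hxF.1 hy.1 hi).1
    have heq := Finset.eq_of_subset_of_card_le hsub (hmin _ hmid)
    intro i hi
    have : i ∈ (Finset.univ.filter (fun i => sg u a x i = 0)) := by simpa using hi
    rw [← heq] at this
    simp only [Finset.mem_filter, Finset.mem_univ, true_and] at this
    exact (mid_zero hT hxF.1 hy.1 this).2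
  · intro hy
    obtain ⟨t, ht, hmem⟩ := extend_back hxF.1 hy
    refine ⟨hy.1, fun z hz => (hxF.2 z hz).trans ?_⟩
    have := hxF.2 _ hmem
    rw [inner_add_right, inner_smul_right, inner_sub_right] at this
    have h2 : t * (⟪v, x⟫ - ⟪v, y⟫) ≤ 0 := by linarith
    by_contra hlt
    push Not at hlt
    have := mul_pos ht (sub_pos.2 hlt)
    linarith

/-- Transfer of a set of points through equality of sign vectors. -/
def transfer {n m : ℕ} (u : Fin m → Euc n) (a b : Fin m → ℝ) (F : Set (Euc n)) : Set (Euc n) :=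
  {y | ∃ x ∈ F, sg u b y = sg u a x}

lemma transfer_tface {n m : ℕ} (u : Fin m → Euc n) (a b : Fin m → ℝ) (hab : SameOpenFace u a b)
    (hba : SameOpenFace u b a) (I J K : Set (Fin m)) {x y : Euc n} (hxy : sg u b y = sg u a x) :
    transfer u a b (tface u a I J K x) = tface u b I J K y := by
  ext z
  simp only [transfer, tface, Set.mem_ofPred_eq, mem_poly_iff]
  constructor
  · rintro ⟨w, hw, hzw⟩
    rw [hzw, hxy]; exact hw
  · intro hz
    obtain ⟨w, hw⟩ := exists_sg u b a hba z
    refine ⟨w, ?_, hw.symm⟩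
    rw [hw, ← hxy]; exact hz

lemma transfer_isFace {n m : ℕ} (u : Fin m → Euc n) (a b : Fin m → ℝ) (hab : SameOpenFace u a b)
    (hba : SameOpenFace u b a) {I J K : Set (Fin m)} (hT : IsTripartition I J K)
    {F : Set (Euc n)} (hF : IsFace (poly u a I J K) F) :
    IsFace (poly u b I J K) (transfer u a b F) := by
  rcases face_eq_tface u a hT hF with rfl | ⟨x, hx, rfl⟩
  · left; simp [transfer]
  · obtain ⟨y, hy⟩ := exists_sg u a b hab x
    rw [transfer_tface u a b hab hba I J K hy]
    apply tface_isFace u b hT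
    rw [mem_poly_iff, hy, ← mem_poly_iff]; exact hx

lemma transfer_transfer {n m : ℕ} (u : Fin m → Euc n) (a b : Fin m → ℝ) (hab : SameOpenFace u a b)
    {I J K : Set (Fin m)} (hT : IsTripartition I J K)
    {F : Set (Euc n)} (hF : IsFace (poly u a I J K) F) :
    transfer u b a (transfer u a b F) = F := by
  ext z
  constructor
  · rintro ⟨y, ⟨x, hx, hyx⟩, hzy⟩
    rcases face_eq_tface u a hT hF with rfl | ⟨w, hw, rfl⟩
    · exact hx.elim
    · have hzx := hzy.trans hyx
      simp only [tface, Set.mem_ofPred_eq, mem_poly_iff] at hx ⊢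
      rw [hzx]; exact hx
  · intro hz
    obtain ⟨y, hy⟩ := exists_sg u a b hab z
    exact ⟨y, ⟨z, hz, hy⟩, hy.symm⟩

lemma transfer_mono {n m : ℕ} (u : Fin m → Euc n) (a b : Fin m → ℝ) {F G : Set (Euc n)}
    (h : F ⊆ G) : transfer u a b F ⊆ transfer u a b G := by
  rintro y ⟨x, hx, e⟩
  exact ⟨x, h hx, e⟩

theorem combinatorially_equivalent_of_sameOpenFace {n m : ℕ} (hn : 1 ≤ n) (hm : 1 ≤ m)
    (u : Fin m → Euc n) (hu : ∀ i, u i ≠ 0)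
    (a b : Fin m → ℝ) (hab : SameOpenFace u a b)
    (I J K : Set (Fin m)) (hIJK : IsTripartition I J K) :
    ∃ Φ : {F : Set (Euc n) // IsFace (poly u a I J K) F} ≃
          {G : Set (Euc n) // IsFace (poly u b I J K) G},
      ∀ F G : {F : Set (Euc n) // IsFace (poly u a I J K) F},
        (F : Set (Euc n)) ⊆ (G : Set (Euc n)) ↔ (Φ F : Set (Euc n)) ⊆ (Φ G : Set (Euc n)) := by
  have hba : SameOpenFace u b a := fun c hc => (hab c hc).symm
  refine ⟨⟨fun F => ⟨transfer u a b F.1, transfer_isFace u a b hab hba hIJK F.2⟩,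
    fun G => ⟨transfer u b a G.1, transfer_isFace u b a hba hab hIJK G.2⟩,
    fun F => Subtype.ext (transfer_transfer u a b hab hIJK F.2),
    fun G => Subtype.ext (transfer_transfer u b a hba hIJK G.2)⟩, ?_⟩
  intro F G
  refine ⟨fun h => transfer_mono u a b h, fun h => ?_⟩
  have h2 := transfer_mono u b a h
  simp only [Equiv.coe_fn_mk] at h2
  rwa [transfer_transfer u a b hab hIJK F.2, transfer_transfer u a b hab hIJK G.2] at h2
end
end

section
/- For all a, b ∈ ℝ^m, the conings cA_a and cA_b are sign equivalent, i.e. sign(cA_a) = sign(cA_b), if and only if a and b lie in the same open face of the derived arrangement δA_o, i.e. for every circuit vector c the numbers ⟨c,a⟩ and ⟨c,b⟩ have the same sign (both zero, both positive, or both negative). -/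
open RealInnerProductSpace

noncomputable section

/-- The set of sign vectors of the coning `cA_a` (the last coordinate records the sign
with respect to the extra hyperplane `x_{n+1} = 0`). -/
def coningSignSet {n m : ℕ} (u : Fin m → Euc n) (a : Fin m → ℝ) :
    Set (Fin (m + 1) → SignType) :=
  {s | ∃ (x : Euc n) (t : ℝ),
    (∀ i : Fin m, s i.castSucc = SignType.sign (⟪u i, x⟫ + a i * t)) ∧
    s (Fin.last m) = SignType.sign t}

lemma gordan {V ι : Type*} [AddCommGroup V] [Module ℝ V] [Fintype ι]
    (l : ι → V →ₗ[ℝ] ℝ) (σ : ι → SignType)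
    (h : ¬ ∃ v, ∀ i, SignType.sign (l i v) = σ i) :
    ∃ c : ι → ℝ, (∀ v, ∑ i, c i * l i v = 0) ∧ (∀ i, 0 ≤ c i * (σ i : ℝ)) ∧
      ∃ i, 0 < c i * (σ i : ℝ) := by
  classical
  let O : Set (ι → ℝ) := {z | ∀ i, σ i ≠ 0 → 0 < z i * (σ i : ℝ)}
  let K : Set (ι → ℝ) := {z | ∃ v, (∀ i, σ i = 0 → l i v = 0) ∧ z = fun i => l i v}
  have hOo : IsOpen O := by
    have : O = ⋂ i, {z : ι → ℝ | σ i ≠ 0 → 0 < z i * (σ i : ℝ)} := by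
      ext z; simp [O]
    rw [this]
    refine isOpen_iInter_of_finite fun i => ?_
    by_cases hi : σ i = 0
    · simp [hi]
    · simp only [ne_eq, hi, not_false_eq_true, forall_const]
      exact isOpen_lt continuous_const (by fun_prop)
  have hOc : Convex ℝ O := by
    intro x hx y hy p q hp hq hpq i hi
    have h1 := hx i hi
    have h2 := hy i hi
    have : (p • x + q • y) i * (σ i : ℝ) = p * (x i * (σ i:ℝ)) + q * (y i * (σ i : ℝ)) := by
      simp; ring
    rw [this]
    rcases hp.eq_or_lt with rfl | hp'
    · have : q = 1 := by linarith
      subst this; simpa using h2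
    · have := mul_pos hp' h1
      have := mul_nonneg hq h2.le
      linarith
  have hKc : Convex ℝ K := by
    rintro _ ⟨v, hv, rfl⟩ _ ⟨w, hw, rfl⟩ p q hp hq hpq
    refine ⟨p • v + q • w, fun i hi => by simp [hv i hi, hw i hi], ?_⟩
    ext i; simp
  have hd : Disjoint O K := by
    rw [Set.disjoint_left]
    rintro _ hz ⟨v, hv, rfl⟩
    apply h
    refine ⟨v, fun i => ?_⟩
    have h1 := hz i
    have h2 := hv i
    revert h1 h2
    rcases SignType.trichotomy (σ i) with hs | hs | hs <;> simp [hs, sign_eq_neg_one_iff, sign_eq_one_iff]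
  obtain ⟨f, α, hf1, hf2⟩ := geometric_hahn_banach_open hOc hOo hKc hd
  have hα : α ≤ 0 := by
    have := hf2 0 ⟨0, by simp, by ext; simp⟩
    simpa using this
  have hfK : ∀ v, (∀ i, σ i = 0 → l i v = 0) → f (fun i => l i v) = 0 := by
    intro v hv
    by_contra hne
    have := hf2 (fun i => l i (((α - 1) / f (fun i => l i v)) • v))
      ⟨_, fun i hi => by simp [hv i hi], rfl⟩
    have e : (fun i => l i (((α - 1) / f (fun i => l i v)) • v)) =
      ((α - 1) / f (fun i => l i v)) • (fun i => l i v) := by ext; simp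
    rw [e, map_smul, smul_eq_mul, div_mul_cancel₀ _ hne] at this
    linarith
  have hfe : ∀ z, f z = ∑ i, f (Pi.single i 1) * z i := by
    intro z
    conv_lhs => rw [pi_eq_sum_univ' z]
    rw [map_sum]
    refine Finset.sum_congr rfl fun i _ => ?_
    rw [map_smul, smul_eq_mul, mul_comm]
  set g : ι → ℝ := fun i => f (Pi.single i 1) with hg
  have hsig : (fun i => (σ i : ℝ)) ∈ O := by
    intro i
    rcases SignType.trichotomy (σ i) with hs | hs | hs <;> simp [hs]
  have hneg : ∀ z ∈ O, f z < 0 := fun z hz => (hf1 z hz).trans_le hα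
  have hgs : ∀ i, g i * (σ i : ℝ) ≤ 0 := by
    intro i
    by_contra! hpos
    set s0 := f (fun i => (σ i : ℝ)) with hs0
    have hs0n : s0 < 0 := hneg _ hsig
    have hN : 0 ≤ -s0 / (g i * (σ i : ℝ)) := div_nonneg (by linarith) hpos.le
    have hmem : (fun i => (σ i : ℝ)) + (-s0 / (g i * (σ i : ℝ)) * (σ i : ℝ)) • Pi.single i (1:ℝ) ∈ O := by
      intro k hk
      have h1 := hsig k hk
      by_cases hki : k = i
      · subst hki
        simp only [Pi.add_apply, Pi.smul_apply, Pi.single_eq_same, smul_eq_mul, mul_one]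
        have := mul_nonneg hN (mul_self_nonneg (σ k : ℝ))
        simp only at h1
        nlinarith
      · simpa [hki] using h1
    have := hneg _ hmem
    rw [map_add, map_smul, smul_eq_mul, ← hs0] at this
    have e : -s0 / (g i * (σ i : ℝ)) * (σ i : ℝ) * f (Pi.single i 1) = -s0 := by
      change -s0 / (g i * (σ i : ℝ)) * (σ i : ℝ) * g i = -s0
      rw [mul_assoc, mul_comm (σ i : ℝ), div_mul_cancel₀ _ hpos.ne']
    rw [e] at this
    linarith
  have hspan : (∑ i, g i • l i) ∈ Submodule.span ℝ (Set.range fun i : {i // σ i = 0} => l i) := by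
    apply mem_span_of_iInf_ker_le_ker
    intro v hv
    simp only [Submodule.mem_iInf, LinearMap.mem_ker, Subtype.forall] at hv
    have := hfK v hv
    rw [hfe] at this
    simpa using this
  rw [Submodule.mem_span_range_iff_exists_fun] at hspan
  obtain ⟨k, hk⟩ := hspan
  have hk2 : ∑ i, (if hi : σ i = 0 then k ⟨i, hi⟩ else 0) • l i = ∑ i, g i • l i := by
    rw [← hk]
    symm
    refine Fintype.sum_of_injective (Subtype.val) Subtype.val_injective _ _ ?_ ?_
    · intro i hi
      have : σ i ≠ 0 := fun h0 => hi ⟨⟨i, h0⟩, rfl⟩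
      simp [this]
    · rintro ⟨i, hi⟩
      simp [hi]
  refine ⟨fun i => (if hi : σ i = 0 then k ⟨i, hi⟩ else 0) - g i, fun v => ?_, fun i => ?_, ?_⟩
  · have := congrArg (fun F => F v) hk2
    simp only [LinearMap.sum_apply, LinearMap.smul_apply, smul_eq_mul] at this
    simp only [sub_mul, Finset.sum_sub_distrib]
    linarith
  · by_cases hi : σ i = 0
    · simp [hi]
    · have := hgs i
      simp [hi]; linarith
  · have h0 := hneg _ hsig
    rw [hfe] at h0
    obtain ⟨i, -, hi⟩ := Finset.exists_lt_of_sum_lt (h0.trans_eq (Finset.sum_const_zero (s := Finset.univ)).symm)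
    refine ⟨i, ?_⟩
    by_cases hs : σ i = 0
    · simp [hs] at hi
    · simp [hs]; linarith

lemma dual_exists {n : ℕ} {ι : Type*} (u : ι → Euc n) (h : LinearIndependent ℝ u) (w : ι → ℝ) :
    ∃ x : Euc n, ∀ i, ⟪u i, x⟫ = w i := by
  obtain ⟨f, hf⟩ : ∃ f : Euc n →ₗ[ℝ] ℝ, ∀ i, f (u i) = w i := by
    let e := Module.Basis.span h
    obtain ⟨f, hf⟩ := (e.constr ℝ w).exists_extend
    refine ⟨f, fun i => ?_⟩
    have := congrArg (fun F => F (e i)) hf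
    simp only [Module.Basis.constr_basis] at this
    rw [← this]
    simp [e, Module.Basis.span_apply]
  refine ⟨(InnerProductSpace.toDual ℝ (Euc n)).symm f.toContinuousLinearMap, fun i => ?_⟩
  rw [real_inner_comm, InnerProductSpace.toDual_symm_apply]
  simpa using hf i

lemma dot_inner {n m : ℕ} (u : Fin m → Euc n) (a c : Fin m → ℝ) (hc : ∑ i, c i • u i = 0)
    (x : Euc n) (t : ℝ) : ∑ i, c i * (⟪u i, x⟫ + a i * t) = t * dotm c a := by
  have : ∑ i, c i * ⟪u i, x⟫ = 0 := by
    have h : ⟪∑ i, c i • u i, x⟫ = 0 := by rw [hc, inner_zero_left]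
    rw [sum_inner] at h
    simpa [real_inner_smul_left] using h
  simp only [mul_add, Finset.sum_add_distrib, this, dotm, Finset.mul_sum, zero_add]
  exact Finset.sum_congr rfl fun i _ => by ring

lemma forward {n m : ℕ} (u : Fin m → Euc n) (a b : Fin m → ℝ)
    (h : coningSignSet u a ⊆ coningSignSet u b) : SameOpenFace u a b := by
  rintro c ⟨hc, hC⟩
  have hne : ∃ i0, c i0 ≠ 0 := by
    by_contra! hz
    apply hC.1
    have : IsEmpty {i | c i ≠ 0} := ⟨fun i => i.2 (hz i)⟩
    exact linearIndependent_empty_type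
  obtain ⟨i0, hi0⟩ := hne
  set N := ∑ i, c i * c i with hN
  have hNpos : 0 < N := by
    have := Finset.single_le_sum (f := fun i => c i * c i) (fun i _ => mul_self_nonneg (c i))
      (Finset.mem_univ i0)
    have := mul_self_pos.2 hi0
    linarith
  set r := dotm c a / N with hr
  obtain ⟨x, hx⟩ := dual_exists _ (hC.2 ({i | c i ≠ 0} \ {i0}) (by
    refine ⟨Set.sdiff_subset, fun hh => ?_⟩
    exact (hh (show i0 ∈ {i | c i ≠ 0} from hi0)).2 rfl)) (fun i => r * c i - a i)
  have hx' : ∀ i, c i ≠ 0 → i ≠ i0 → ⟪u i, x⟫ + a i * 1 = r * c i := by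
    intro i h1 h2
    have := hx ⟨i, h1, h2⟩
    simp only at this
    rw [this]; ring
  have hall : ∀ i, c i ≠ 0 → ⟪u i, x⟫ + a i * 1 = r * c i := by
    intro i h1
    by_cases h2 : i = i0
    swap
    · exact hx' i h1 h2
    subst h2
    have h3 := dot_inner u a c hc x 1
    have h4 : ∑ i, c i * (r * c i) = 1 * dotm c a := by
      have : ∑ i, c i * (r * c i) = r * N := by
        rw [hN, Finset.mul_sum]
        exact Finset.sum_congr rfl fun i _ => by ring
      rw [this, hr, div_mul_cancel₀ _ hNpos.ne', one_mul]
    rw [← h4, ← Finset.add_sum_erase _ _ (Finset.mem_univ i),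
      ← Finset.add_sum_erase _ _ (Finset.mem_univ i)] at h3
    have h5 : ∑ j ∈ Finset.univ.erase i, c j * (⟪u j, x⟫ + a j * 1) =
        ∑ j ∈ Finset.univ.erase i, c j * (r * c j) := by
      refine Finset.sum_congr rfl fun j hj => ?_
      by_cases hcj : c j = 0
      · simp [hcj]
      · rw [hx' j hcj (Finset.ne_of_mem_erase hj)]
    rw [h5] at h3
    exact mul_left_cancel₀ h1 (add_right_cancel h3)
  have hmem : (Fin.snoc (α := fun _ => SignType) (fun i => SignType.sign (⟪u i, x⟫ + a i * 1))
      (SignType.sign (1:ℝ)) : Fin (m+1) → SignType) ∈ coningSignSet u a :=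
    ⟨x, 1, fun i => by simp, by simp⟩
  obtain ⟨y, t, hy, ht⟩ := h hmem
  simp only [Fin.snoc_castSucc, Fin.snoc_last] at hy ht
  have ht0 : 0 < t := by
    rw [sign_one] at ht
    exact sign_eq_one_iff.1 ht.symm
  have hb := dot_inner u b c hc y t
  have hsr : SignType.sign (dotm c a) = SignType.sign r := by
    have : dotm c a = r * N := by rw [hr, div_mul_cancel₀ _ hNpos.ne']
    rw [this, sign_mul, sign_pos hNpos, mul_one]
  have hsb : SignType.sign (dotm c b) = SignType.sign (t * dotm c b) := by
    rw [sign_mul, sign_pos ht0, one_mul]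
  rw [hsr, hsb, ← hb]
  have key : ∀ i, c i ≠ 0 → SignType.sign (c i * (⟪u i, y⟫ + b i * t)) = SignType.sign r := by
    intro i hi
    rw [sign_mul, ← hy i, hall i hi, sign_mul, mul_left_comm, ← sign_mul, 
      sign_pos (mul_self_pos.2 hi), mul_one]
  rcases lt_trichotomy r 0 with hr0 | hr0 | hr0
  · rw [sign_neg hr0] at key ⊢
    symm
    rw [sign_eq_neg_one_iff]
    refine (Finset.sum_lt_sum (g := fun _ => (0:ℝ)) (fun i _ => ?_) ⟨i0, Finset.mem_univ _, ?_⟩).trans_eq (by simp)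
    · by_cases hi : c i = 0
      · simp [hi]
      · exact (sign_eq_neg_one_iff.1 (key i hi)).le
    · exact sign_eq_neg_one_iff.1 (key i0 hi0)
  · rw [hr0, sign_zero] at key ⊢
    symm
    rw [sign_eq_zero_iff]
    refine Finset.sum_eq_zero fun i _ => ?_
    by_cases hi : c i = 0
    · simp [hi]
    · exact sign_eq_zero_iff.1 (key i hi)
  · rw [sign_pos hr0] at key ⊢
    symm
    rw [sign_eq_one_iff]
    refine Finset.sum_pos' (fun i _ => ?_) ⟨i0, Finset.mem_univ _, ?_⟩
    · by_cases hi : c i = 0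
      · simp [hi]
      · exact (sign_eq_one_iff.1 (key i hi)).le
    · exact sign_eq_one_iff.1 (key i0 hi0)

lemma dep_exists {n m : ℕ} (u : Fin m → Euc n) (D : Set (Fin m))
    (h : ¬ LinearIndependent ℝ (fun i : D => u i)) :
    ∃ d : Fin m → ℝ, ∑ i, d i • u i = 0 ∧ (∀ i, d i ≠ 0 → i ∈ D) ∧ ∃ i, d i ≠ 0 := by
  classical
  rw [Fintype.not_linearIndependent_iff] at h
  obtain ⟨g, hg, ⟨i, hi⟩, hgi⟩ := h
  refine ⟨fun i => if h : i ∈ D then g ⟨i, h⟩ else 0, ?_, fun j hj => ?_, i, ?_⟩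
  · rw [← hg]
    symm
    refine Fintype.sum_of_injective (Subtype.val) Subtype.val_injective _ _ ?_ ?_
    · intro i hi
      have : i ∉ D := fun h0 => hi ⟨⟨i, h0⟩, rfl⟩
      simp [this]
    · rintro ⟨i, hi⟩
      simp [hi]
  · by_contra hjD
    simp [hjD] at hj
  · simpa [hi] using hgi

lemma supp_dep {n m : ℕ} (u : Fin m → Euc n) (c : Fin m → ℝ) (hc : ∑ i, c i • u i = 0)
    (hne : ∃ i, c i ≠ 0) : ¬ LinearIndependent ℝ (fun i : {i | c i ≠ 0} => u i) := by
  classical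
  rw [Fintype.not_linearIndependent_iff]
  obtain ⟨i, hi⟩ := hne
  refine ⟨fun j => c j, ?_, ⟨i, hi⟩, hi⟩
  rw [← hc]
  refine Fintype.sum_of_injective (Subtype.val) Subtype.val_injective _ _ ?_ ?_
  · intro i hi
    have : c i = 0 := by
      by_contra h0
      exact hi ⟨⟨i, h0⟩, rfl⟩
    simp [this]
  · rintro ⟨i, hi⟩
    simp

/-- Conformal decomposition: positivity on circuit vectors gives positivity on dependencies. -/
lemma conf {n m : ℕ} (u : Fin m → Euc n) (b : Fin m → ℝ) (s : Fin m → ℝ)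
    (H : ∀ c, IsCircuitVector u c → (∀ i, 0 ≤ c i * s i) →
      0 ≤ dotm c b ∧ ((∃ i, 0 < c i * s i) → 0 < dotm c b)) :
    ∀ (k : ℕ) (c : Fin m → ℝ), (Finset.univ.filter fun i => c i ≠ 0).card ≤ k →
      ∑ i, c i • u i = 0 → (∀ i, 0 ≤ c i * s i) →
      0 ≤ dotm c b ∧ ((∃ i, 0 < c i * s i) → 0 < dotm c b) := by
  intro k
  induction k with
  | zero =>
    intro c hk hc hs
    have h0 : ∀ i, c i = 0 := by
      simpa [Finset.filter_eq_empty_iff] using hk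
    simp [dotm, h0]
  | succ k ih =>
    intro c hk hc hs
    by_cases hne : ∃ i, c i ≠ 0
    swap
    · push Not at hne
      simp [dotm, hne]
    by_cases hcirc : IsCircuit u {i | c i ≠ 0}
    · exact H c ⟨hc, hcirc⟩ hs
    obtain ⟨D, hD, hDd⟩ : ∃ D : Set (Fin m), D ⊂ {i | c i ≠ 0} ∧
        ¬ LinearIndependent ℝ (fun i : D => u i) := by
      by_contra! hh
      exact hcirc ⟨supp_dep u c hc hne, hh⟩
    obtain ⟨d, hd, hdD, i1, hi1⟩ := dep_exists u D hDd
    obtain ⟨i2, hi2c, hi2D⟩ := Set.exists_of_ssubset hD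
    have hd2 : d i2 = 0 := by
      by_contra h0
      exact hi2D (hdD _ h0)
    have hi1c : c i1 ≠ 0 := hD.1 (hdD _ hi1)
    set S := Finset.univ.filter fun i => c i ≠ 0 with hS
    have memS : ∀ i, i ∈ S ↔ c i ≠ 0 := fun i => by simp [hS]
    have hSne : S.Nonempty := ⟨i1, (memS _).2 hi1c⟩
    obtain ⟨p, hp, hpmax⟩ := S.exists_max_image (fun i => d i / c i) hSne
    obtain ⟨q, hq, hqmin⟩ := S.exists_min_image (fun i => d i / c i) hSne
    set M := d p / c p with hM
    set μ := d q / c q with hμ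
    have hdq : ∀ i, d i = d i / c i * c i := by
      intro i
      by_cases h0 : c i = 0
      · have : d i = 0 := by
          by_contra h1
          exact hD.1 (hdD _ h1) h0
        simp [this]
      · rw [div_mul_cancel₀ _ h0]
    have hMμ : μ < M := by
      have e1 := hpmax i1 ((memS _).2 hi1c)
      have e2 := hpmax i2 ((memS _).2 hi2c)
      have e3 := hqmin i1 ((memS _).2 hi1c)
      have e4 := hqmin i2 ((memS _).2 hi2c)
      simp only [hd2, zero_div] at e2 e4
      have : d i1 / c i1 ≠ 0 := div_ne_zero hi1 hi1c
      rcases lt_or_gt_of_ne this with h | h <;> linarith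
    have step : ∀ (e ρ : Fin m → ℝ) (j : Fin m), (∀ i, e i = ρ i * c i) →
        (∀ i, c i ≠ 0 → 0 ≤ ρ i) → c j ≠ 0 → e j = 0 → ∑ i, e i • u i = 0 →
        (∀ i, 0 ≤ e i * s i) ∧
        (0 ≤ dotm e b ∧ ((∃ i, 0 < e i * s i) → 0 < dotm e b)) := by
      intro e ρ j he hρ hj hej hsum
      have hnn : ∀ i, 0 ≤ e i * s i := by
        intro i
        by_cases h0 : c i = 0
        · simp [he, h0]
        · rw [he, mul_assoc]
          exact mul_nonneg (hρ i h0) (hs i)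
      refine ⟨hnn, ih e ?_ hsum hnn⟩
      have : (Finset.univ.filter fun i => e i ≠ 0) ⊂ S := by
        rw [Finset.ssubset_iff_of_subset]
        · exact ⟨j, (memS j).2 hj, by simp [hej]⟩
        · intro i hi
          rw [memS]
          intro h0
          simp [he, h0] at hi
      have := Finset.card_lt_card this
      omega
    have sum1 : ∑ i, (M * c i - d i) • u i = 0 := by
      simp only [sub_smul, mul_smul, Finset.sum_sub_distrib, ← Finset.smul_sum, hc, hd]
      simp
    have sum2 : ∑ i, (d i - μ * c i) • u i = 0 := by
      simp only [sub_smul, mul_smul, Finset.sum_sub_distrib, ← Finset.smul_sum, hc, hd]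
      simp
    obtain ⟨n1, A1, B1⟩ := step (fun i => M * c i - d i) (fun i => M - d i / c i) p
      (fun i => by rw [sub_mul, ← hdq]) (fun i hi => sub_nonneg.2 (hpmax i ((memS i).2 hi)))
      ((memS p).1 hp) (by rw [hM, ← hdq, sub_self]) sum1
    obtain ⟨n2, A2, B2⟩ := step (fun i => d i - μ * c i) (fun i => d i / c i - μ) q
      (fun i => by rw [sub_mul, ← hdq]) (fun i hi => sub_nonneg.2 (hqmin i ((memS i).2 hi)))
      ((memS q).1 hq) (by rw [hμ, ← hdq, sub_self]) sum2
    have hsum : (M - μ) * dotm c b = dotm (fun i => M * c i - d i) b +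
        dotm (fun i => d i - μ * c i) b := by
      simp only [dotm, Finset.mul_sum, ← Finset.sum_add_distrib]
      exact Finset.sum_congr rfl fun i _ => by ring
    have hpos : 0 < M - μ := sub_pos.2 hMμ
    refine ⟨?_, ?_⟩
    · refine nonneg_of_mul_nonneg_right ?_ hpos
      rw [hsum]; linarith
    · rintro ⟨i, hi⟩
      refine pos_of_mul_pos_right ?_ hpos.le
      rw [hsum]
      have e : (M - μ) * (c i * s i) = (M * c i - d i) * s i + (d i - μ * c i) * s i := by ring
      have e' := mul_pos hpos hi
      rcases (n1 i).lt_or_eq with h1 | h1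
      · have := B1 ⟨i, h1⟩
        linarith
      · have := B2 ⟨i, by linarith⟩
        linarith

lemma backward {n m : ℕ} (u : Fin m → Euc n) (a b : Fin m → ℝ)
    (h : SameOpenFace u a b) : coningSignSet u a ⊆ coningSignSet u b := by
  rintro σ ⟨x, t, hx, ht⟩
  by_contra hnot
  let l : Fin (m + 1) → (Euc n × ℝ) →ₗ[ℝ] ℝ :=
    Fin.snoc (α := fun _ => (Euc n × ℝ) →ₗ[ℝ] ℝ)
      (fun i => (innerₛₗ ℝ (u i)).comp (LinearMap.fst ℝ _ _) + b i • LinearMap.snd ℝ _ _)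
      (LinearMap.snd ℝ _ _)
  have hl1 : ∀ (i : Fin m) v, l i.castSucc v = ⟪u i, v.1⟫ + b i * v.2 := by
    intro i v; simp [l]
  have hl2 : ∀ v, l (Fin.last m) v = v.2 := by
    intro v; simp [l]
  obtain ⟨c, hc0, hc1, hc2⟩ := gordan l σ (by
    rintro ⟨v, hv⟩
    apply hnot
    exact ⟨v.1, v.2, fun i => by rw [← hv, hl1], by rw [← hv, hl2]⟩)
  set c' : Fin m → ℝ := fun i => c i.castSucc with hc'
  have hdep : ∑ i, c' i • u i = 0 := by
    have := hc0 (∑ i, c' i • u i, 0)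
    rw [Fin.sum_univ_castSucc] at this
    simp only [hl1, hl2, mul_zero, add_zero] at this
    rw [← inner_self_eq_zero (𝕜 := ℝ)]
    conv_lhs => rw [sum_inner]
    simpa only [real_inner_smul_left] using this
  have hlast : c (Fin.last m) = - dotm c' b := by
    have := hc0 (0, 1)
    rw [Fin.sum_univ_castSucc] at this
    simp only [hl1, hl2, mul_one, inner_zero_right, zero_add] at this
    simp only [dotm, hc']
    linarith
  have hsg : ∀ r : ℝ, ((SignType.sign r : SignType) : ℝ) * |r| = r := fun r => sign_mul_abs r
  have hsgt : ∀ (y r : ℝ), y * r = y * ((SignType.sign r : SignType) : ℝ) * |r| := by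
    intro y r; rw [mul_assoc, hsg]
  have hdt : ∀ e : Fin m → ℝ, dotm e (fun i => b i * t) = t * dotm e b := by
    intro e
    simp only [dotm, Finset.mul_sum]
    exact Finset.sum_congr rfl fun i _ => by ring
  have key := conf u (fun i => b i * t) (fun i => ((σ i.castSucc : SignType) : ℝ)) (by
    intro e he hes
    have e1 := dot_inner u a e he.1 x t
    have hnn : ∀ i, 0 ≤ e i * (⟪u i, x⟫ + a i * t) := by
      intro i
      rw [hsgt, ← hx i]
      exact mul_nonneg (hes i) (abs_nonneg _)
    have hsame : SignType.sign (t * dotm e b) = SignType.sign (t * dotm e a) := by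
      rw [sign_mul, sign_mul, h e he]
    rw [hdt]
    constructor
    · rw [← sign_nonneg_iff, hsame, sign_nonneg_iff, ← e1]
      exact Finset.sum_nonneg fun i _ => hnn i
    · rintro ⟨i, hi⟩
      rw [← sign_eq_one_iff, hsame, sign_eq_one_iff, ← e1]
      refine Finset.sum_pos' (fun i _ => hnn i) ⟨i, Finset.mem_univ _, ?_⟩
      rw [hsgt, ← hx i]
      refine mul_pos hi (abs_pos.2 fun h0 => ?_)
      rw [hx i, h0] at hi
      simp at hi) _ c' le_rfl hdep (fun i => hc1 _)
  rw [hdt] at key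
  have hl := hc1 (Fin.last m)
  rw [hlast, ht] at hl
  have e3 := hsgt (-dotm c' b) t
  obtain ⟨i, hi⟩ := hc2
  induction i using Fin.lastCases with
  | last =>
    rw [hlast, ht] at hi
    have : 0 < |t| := by
      refine abs_pos.2 fun h0 => ?_
      rw [h0] at hi
      simp at hi
    have := mul_pos hi this
    linarith [key.1]
  | cast i =>
    have := key.2 ⟨i, hi⟩
    have := mul_nonneg hl (abs_nonneg t)
    linarith

theorem coning_sign_equivalent_iff_sameOpenFace {n m : ℕ} (hn : 1 ≤ n) (hm : 1 ≤ m)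
    (u : Fin m → Euc n) (hu : ∀ i, u i ≠ 0) (a b : Fin m → ℝ) :
    coningSignSet u a = coningSignSet u b ↔ SameOpenFace u a b := by
  constructor
  · intro h
    exact forward u a b h.subset
  · intro h
    exact Set.Subset.antisymm (backward u a b h) (backward u b a fun c hc => (h c hc).symm)
end
end

section
/- Let a, b ∈ ℝ^m lie in the same open face of the derived arrangement δA_o and let I, J, K be a partition of {1,…,m}. For each nonempty face G of P(a,I,J,K) set I(G) := {i ∈ {1,…,m} : ⟨u_i,x⟩ = a_i for every x ∈ G} and Φ(G) := P(b, I(G), J∖I(G), K∖I(G)). Then Φ is a bijection from the set of nonempty faces of P(a,I,J,K) onto the set of nonempty faces of P(b,I,J,K), and for every nonempty face G of P(a,I,J,K) one has {i ∈ {1,…,m} : ⟨u_i,y⟩ = b_i for every y ∈ Φ(G)} = I(G). -/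
open RealInnerProductSpace

noncomputable section

/-- The active index set of a subset `G` of `ℝ^n` with respect to `a`. -/
def activeSet {n m : ℕ} (u : Fin m → Euc n) (a : Fin m → ℝ) (G : Set (Euc n)) :
    Set (Fin m) :=
  {i | ∀ x ∈ G, ⟪u i, x⟫ = a i}

/-! ### Circuits -/

/-- Elimination step. -/
theorem elim_step {m : ℕ} (c e : Fin m → ℝ) (hsup : ∀ i, c i = 0 → e i = 0)
    (hpos : ∃ i, 0 < c i * e i) :
    ∃ t : ℝ, 0 < t ∧ (∀ i, 0 ≤ c i * (c i - t * e i)) ∧ ∃ i, c i ≠ 0 ∧ c i - t * e i = 0 := by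
  classical
  obtain ⟨i0, hi0⟩ := hpos
  obtain ⟨k, hk, hmin⟩ := Finset.exists_min_image
    (Finset.univ.filter (fun i => 0 < c i * e i)) (fun i => c i / e i) ⟨i0, by simpa using hi0⟩
  have hk' : 0 < c k * e k := by simpa using hk
  have hck : c k ≠ 0 := by rintro h; simp [h] at hk'
  have hek : e k ≠ 0 := by rintro h; simp [h] at hk'
  refine ⟨c k / e k, ?_, ?_, k, hck, by field_simp; ring⟩
  · have : c k / e k = c k * e k / (e k * e k) := by field_simp
    rw [this]
    exact div_pos hk' (mul_self_pos.2 hek)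
  · intro i
    have htpos : 0 < c k / e k := by
      have : c k / e k = c k * e k / (e k * e k) := by field_simp
      rw [this]
      exact div_pos hk' (mul_self_pos.2 hek)
    by_cases hi : 0 < c i * e i
    · have h1 := hmin i (by simpa using hi)
      have hei : e i ≠ 0 := by rintro h; simp [h] at hi
      have h2 : c i * (c i - c k / e k * e i) = (c i * e i) * (c i / e i - c k / e k) := by
        field_simp
      rw [h2]
      exact mul_nonneg hi.le (sub_nonneg.2 h1)
    · push Not at hi
      nlinarith [mul_self_nonneg (c i), mul_nonneg htpos.le (neg_nonneg.2 hi)]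

theorem isCircuitVector_of_minimal {n m : ℕ} (u : Fin m → Euc n) (d : Fin m → ℝ)
    (hd : ∑ i, d i • u i = 0) (hd0 : d ≠ 0)
    (hmin : ∀ e : Fin m → ℝ, ∑ i, e i • u i = 0 → (∀ i, d i = 0 → e i = 0) →
      (∃ i, d i ≠ 0 ∧ e i = 0) → e = 0) : IsCircuitVector u d := by
  classical
  refine ⟨hd, ?_, ?_⟩
  · intro hli
    rw [Fintype.linearIndependent_iff] at hli
    apply hd0
    have h := hli (fun i => d i) (by
      rw [← hd]
      refine Fintype.sum_of_injective Subtype.val Subtype.val_injective _ _ ?_ (fun i => rfl)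
      intro i hi
      have : d i = 0 := by
        by_contra h
        exact hi ⟨⟨i, h⟩, rfl⟩
      simp [this])
    funext i
    by_contra hi
    exact hi (h ⟨i, hi⟩)
  · intro D hD
    rw [Fintype.linearIndependent_iff]
    intro g hg
    have he := hmin (fun i => if h : i ∈ D then g ⟨i, h⟩ else 0) (by
      rw [← hg]
      symm
      refine Fintype.sum_of_injective Subtype.val Subtype.val_injective _ _ ?_ ?_
      · intro i hi
        have : i ∉ D := fun h => hi ⟨⟨i, h⟩, rfl⟩
        simp [this]
      · rintro ⟨i, hi⟩
        simp [hi]) (by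
        intro i hi
        have : i ∉ D := fun h => hD.1 h hi
        simp [this]) (by
        obtain ⟨i, hi, hi'⟩ := Set.exists_of_ssubset hD
        exact ⟨i, hi, by simp [hi']⟩)
    rintro ⟨i, hi⟩
    have := congrFun he i
    simpa [hi] using this

theorem exists_conformal_circuit {n m : ℕ} (u : Fin m → Euc n) :
    ∀ (N : ℕ) (c : Fin m → ℝ), (Finset.univ.filter (fun i => c i ≠ 0)).card ≤ N →
      ∑ i, c i • u i = 0 → c ≠ 0 →
      ∃ d, IsCircuitVector u d ∧ (∀ i, c i = 0 → d i = 0) ∧ (∀ i, 0 ≤ c i * d i) ∧ d ≠ 0 := by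
  classical
  intro N
  induction N with
  | zero =>
    intro c hc _ hc0
    exfalso
    apply hc0
    funext i
    by_contra hi
    have : i ∈ Finset.univ.filter (fun i => c i ≠ 0) := by simpa using hi
    rw [Finset.card_eq_zero.1 (Nat.le_zero.1 hc)] at this
    simp at this
  | succ N ih =>
    intro c hc hk hc0
    by_cases hmin : ∀ e : Fin m → ℝ, ∑ i, e i • u i = 0 → (∀ i, c i = 0 → e i = 0) →
      (∃ i, c i ≠ 0 ∧ e i = 0) → e = 0
    · exact ⟨c, isCircuitVector_of_minimal u c hk hc0 hmin, fun i h => h,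
        fun i => mul_self_nonneg _, hc0⟩
    · push Not at hmin
      obtain ⟨e, he, hsup, ⟨k, hk1, hk2⟩, he0⟩ := hmin
      -- choose the sign of e
      have key : ∃ e : Fin m → ℝ, ∑ i, e i • u i = 0 ∧ (∀ i, c i = 0 → e i = 0) ∧ e k = 0 ∧
          ∃ i, 0 < c i * e i := by
        obtain ⟨j, hj⟩ := Function.ne_iff.1 he0
        have hcj : c j ≠ 0 := fun h => hj (hsup j h)
        rcases lt_or_gt_of_ne (mul_ne_zero hcj hj) with h | h
        · refine ⟨fun i => - e i, by simp [he], fun i hi => by simp [hsup i hi], by simp [hk2],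
            j, by simpa using h⟩
        · exact ⟨e, he, hsup, hk2, j, h⟩
      obtain ⟨e, he, hsup, hk2, hpos⟩ := key
      obtain ⟨t, ht, hconf, l, hl1, hl2⟩ := elim_step c e hsup hpos
      obtain ⟨d, hd1, hd2, hd3, hd4⟩ := ih (fun i => c i - t * e i) (by
          have : Finset.univ.filter (fun i => c i - t * e i ≠ 0) ⊂
              Finset.univ.filter (fun i => c i ≠ 0) := by
            refine (Finset.ssubset_iff_of_subset ?_).2 ⟨l, by simpa using hl1, by simpa using hl2⟩
            intro i
            simp only [Finset.mem_filter, Finset.mem_univ, true_and]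
            intro h h'
            apply h
            simp [h', hsup i h']
          have := Finset.card_lt_card this
          omega) (by
          simp only [sub_smul, Finset.sum_sub_distrib, hk, mul_smul, ← Finset.smul_sum, he]
          simp) (by
          intro h
          have := congrFun h k
          simp [hk2] at this
          exact hk1 this)
      refine ⟨d, hd1, fun i hi => hd2 i (by simp [hi, hsup i hi]), fun i => ?_, hd4⟩
      have h1 := hconf i
      have h2 := hd3 i
      by_cases hz : c i - t * e i = 0
      · simp [hd2 i hz]
      · have h3 : 0 ≤ (c i * d i) * ((c i - t * e i) * (c i - t * e i)) := by
          have := mul_nonneg h1 h2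
          linarith
        exact nonneg_of_mul_nonneg_left h3 (mul_self_pos.2 hz)

theorem dotm_kernel {n m : ℕ} (u : Fin m → Euc n) (a : Fin m → ℝ) (x : Euc n) (d : Fin m → ℝ)
    (hd : ∑ i, d i • u i = 0) : ∑ i, d i * (⟪u i, x⟫ - a i) = - dotm d a := by
  have h : ∑ i, d i * ⟪u i, x⟫ = 0 := by
    have : ⟪∑ i, d i • u i, x⟫ = 0 := by rw [hd]; simp
    rw [sum_inner] at this
    simpa [real_inner_smul_left] using this
  simp [mul_sub, Finset.sum_sub_distrib, h, dotm]

theorem kernel_dot {n m : ℕ} (u : Fin m → Euc n) (a b : Fin m → ℝ) (hab : SameOpenFace u a b)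
    (x : Euc n) :
    ∀ (N : ℕ) (c : Fin m → ℝ), (Finset.univ.filter (fun i => c i ≠ 0)).card ≤ N →
      ∑ i, c i • u i = 0 → (∀ i, 0 ≤ c i * (⟪u i, x⟫ - a i)) →
      dotm c b ≤ 0 ∧ (dotm c b = 0 → ∀ i, c i * (⟪u i, x⟫ - a i) = 0) := by
  classical
  intro N
  induction N with
  | zero =>
    intro c hc _ _
    have hc0 : c = 0 := by
      funext i
      by_contra hi
      have : i ∈ Finset.univ.filter (fun i => c i ≠ 0) := by simpa using hi
      rw [Finset.card_eq_zero.1 (Nat.le_zero.1 hc)] at this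
      simp at this
    simp [hc0, dotm]
  | succ N ih =>
    intro c hc hk hz
    by_cases hc0 : c = 0
    · simp [hc0, dotm]
    obtain ⟨d, hd1, hd2, hd3, hd4⟩ := exists_conformal_circuit u _ c le_rfl hk hc0
    have hdz : ∀ i, 0 ≤ d i * (⟪u i, x⟫ - a i) := by
      intro i
      by_cases h : c i = 0
      · simp [hd2 i h]
      · have h3 : 0 ≤ (d i * (⟪u i, x⟫ - a i)) * (c i * c i) := by
          have := mul_nonneg (hd3 i) (hz i)
          linarith
        exact nonneg_of_mul_nonneg_left h3 (mul_self_pos.2 h)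
    have hda := dotm_kernel u a x d hd1.1
    have hda0 : dotm d a ≤ 0 := by
      have := Finset.sum_nonneg (fun i (_ : i ∈ Finset.univ) => hdz i)
      linarith
    have hs := hab d hd1
    have hdb : dotm d b ≤ 0 ∧ (dotm d b = 0 → ∀ i, d i * (⟪u i, x⟫ - a i) = 0) := by
      constructor
      · rcases hda0.lt_or_eq with h | h
        · rw [sign_neg h] at hs
          exact (sign_eq_neg_one_iff.1 hs.symm).le
        · rw [h, sign_zero] at hs
          exact (sign_eq_zero_iff.1 hs.symm).le
      · intro h i
        rw [h, sign_zero] at hs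
        rw [sign_eq_zero_iff.1 hs, neg_zero] at hda
        exact (Finset.sum_eq_zero_iff_of_nonneg (fun i _ => hdz i)).1 hda i (Finset.mem_univ i)
    have hpos : ∃ i, 0 < c i * d i := by
      obtain ⟨j, hj⟩ := Function.ne_iff.1 hd4
      exact ⟨j, lt_of_le_of_ne (hd3 j) (Ne.symm (mul_ne_zero (fun h => hj (hd2 j h)) hj))⟩
    obtain ⟨t, ht, hconf, l, hl1, hl2⟩ := elim_step c d hd2 hpos
    obtain ⟨h1, h2⟩ := ih (fun i => c i - t * d i) (by
          have : Finset.univ.filter (fun i => c i - t * d i ≠ 0) ⊂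
              Finset.univ.filter (fun i => c i ≠ 0) := by
            refine (Finset.ssubset_iff_of_subset ?_).2 ⟨l, by simpa using hl1, by simpa using hl2⟩
            intro i
            simp only [Finset.mem_filter, Finset.mem_univ, true_and]
            intro h h'
            apply h
            simp [h', hd2 i h']
          have := Finset.card_lt_card this
          omega) (by
          simp only [sub_smul, Finset.sum_sub_distrib, hk, mul_smul, ← Finset.smul_sum, hd1.1]
          simp) (by
          intro i
          by_cases h : c i = 0
          · simp [hd2 i h, h]
          · have h3 : 0 ≤ ((c i - t * d i) * (⟪u i, x⟫ - a i)) * (c i * c i) := by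
              have := mul_nonneg (hconf i) (hz i)
              linarith
            exact nonneg_of_mul_nonneg_left h3 (mul_self_pos.2 h))
    have hsplit : dotm (fun i => c i - t * d i) b = dotm c b - t * dotm d b := by
      simp [dotm, sub_mul, Finset.sum_sub_distrib, Finset.mul_sum, mul_assoc]
    rw [hsplit] at h1 h2
    have htd : t * dotm d b ≤ 0 := mul_nonpos_of_nonneg_of_nonpos ht.le hdb.1
    refine ⟨by linarith, fun h i => ?_⟩
    have e1 : t * dotm d b = 0 := by linarith
    have e2 := h2 (by linarith) i
    have e3 := hdb.2 ((mul_eq_zero.1 e1).resolve_left ht.ne') i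
    linear_combination e2 + t * e3

/-! ### Sign vectors -/

theorem exists_same_sign {n m : ℕ} (u : Fin m → Euc n) (a b : Fin m → ℝ)
    (hab : SameOpenFace u a b) (x : Euc n) :
    ∃ y : Euc n, ∀ i, SignType.sign (⟪u i, y⟫ - b i) = SignType.sign (⟪u i, x⟫ - a i) := by
  classical
  set z0 : Fin m → ℝ := fun i => ⟪u i, x⟫ - a i with hz0
  let T : (Euc n × (Fin m → ℝ)) →ₗ[ℝ] (Fin m → ℝ) :=
    { toFun := fun p i => ⟪u i, p.1⟫ - z0 i * p.2 i
      map_add' := by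
        intro p q; funext i; simp [inner_add_right]; ring
      map_smul' := by
        intro r p; funext i; simp [real_inner_smul_right]; ring }
  have hT : ∀ p i, T p i = ⟪u i, p.1⟫ - z0 i * p.2 i := fun p i => rfl
  -- functionals
  have hfun : ∀ g : (Fin m → ℝ) →ₗ[ℝ] ℝ, ∃ c : Fin m → ℝ, ∀ w, g w = ∑ i, c i * w i := by
    intro g
    refine ⟨fun i => g (Pi.single i 1), fun w => ?_⟩
    conv_lhs => rw [pi_eq_sum_univ' w]
    simp [map_sum, mul_comm]
  have hgT : ∀ c : Fin m → ℝ, ∀ p, ∑ i, c i * T p i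
      = ⟪∑ i, c i • u i, p.1⟫ - ∑ i, c i * z0 i * p.2 i := by
    intro c p
    simp only [hT, mul_sub, Finset.sum_sub_distrib, sum_inner, real_inner_smul_left, mul_assoc]
  by_cases hbr : b ∈ LinearMap.range T
  · obtain ⟨p, hp⟩ := hbr
    let O : Set (Euc n × (Fin m → ℝ)) := {q | ∀ i, 0 < q.2 i}
    by_cases hO : ∃ q ∈ O, T q = b
    · obtain ⟨q, hq, hqb⟩ := hO
      refine ⟨q.1, fun i => ?_⟩
      have h1 := congrFun hqb i
      rw [hT] at h1
      have h2 : ⟪u i, q.1⟫ - b i = z0 i * q.2 i := by linarith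
      rw [h2, sign_mul, sign_pos (hq i), mul_one]
    · exfalso
      push Not at hO
      have hOc : Convex ℝ O := by
        intro q hq r hr s t hs ht hst i
        simp only [Prod.snd_add, Prod.smul_snd, Pi.add_apply, Pi.smul_apply, smul_eq_mul]
        rcases hs.lt_or_eq with h | h
        · have := mul_pos h (hq i)
          have := mul_nonneg ht (hr i).le
          linarith
        · have : t = 1 := by linarith
          rw [← h, this]; simpa using hr i
      have hOo : IsOpen O := by
        have : O = ⋂ i, {q | 0 < q.2 i} := by ext q; simp [O]
        rw [this]
        exact isOpen_iInter_of_finite fun i => isOpen_lt continuous_const (by fun_prop)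
      have hLc : Convex ℝ {q | T q = b} := by
        intro q hq r hr s t hs ht hst
        simp only [Set.mem_ofPred_eq] at *
        rw [map_add, map_smul, map_smul, hq, hr, ← add_smul, hst, one_smul]
      obtain ⟨f, r, hf1, hf2⟩ := geometric_hahn_banach_open hOc hOo hLc
        (Set.disjoint_left.2 fun q hq hq' => hO q hq hq')
      have hker : LinearMap.ker T ≤ LinearMap.ker (f : (Euc n × (Fin m → ℝ)) →ₗ[ℝ] ℝ) := by
        intro k hk
        rw [LinearMap.mem_ker] at hk ⊢
        by_contra hne
        have := hf2 (p + ((r - 1 - f p) / f k) • k) (by simp [hp, hk])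
        have hne' : f k ≠ 0 := hne
        rw [map_add, map_smul, smul_eq_mul, div_mul_cancel₀ _ hne'] at this
        linarith
      obtain ⟨g, hg⟩ : ∃ g : (Fin m → ℝ) →ₗ[ℝ] ℝ,
          g ∘ₗ T = (f : (Euc n × (Fin m → ℝ)) →ₗ[ℝ] ℝ) := by
        have : (f : (Euc n × (Fin m → ℝ)) →ₗ[ℝ] ℝ) ∈ LinearMap.range T.dualMap := by
          rw [LinearMap.range_dualMap_eq_dualAnnihilator_ker, Submodule.mem_dualAnnihilator]
          intro w hw
          exact hker hw
        exact this
      obtain ⟨c, hc⟩ := hfun g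
      have hfc : ∀ q, f q = ⟪∑ i, c i • u i, q.1⟫ - ∑ i, c i * z0 i * q.2 i := by
        intro q
        rw [← hgT, ← hc]
        exact (LinearMap.congr_fun hg q).symm
      have hfb : r ≤ dotm c b := by
        have h1 := hf2 p hp
        have h2 : f p = g (T p) := (LinearMap.congr_fun hg p).symm
        rw [h2, hp, hc] at h1
        exact h1
      have hlt : ∀ q ∈ O, ⟪∑ i, c i • u i, q.1⟫ - ∑ i, c i * z0 i * q.2 i < dotm c b := by
        intro q hq
        rw [← hfc]
        exact (hf1 q hq).trans_le hfb
      have hk : ∑ i, c i • u i = 0 := by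
        by_contra hne
        set v := ∑ i, c i • u i
        have hvv : ⟪v, v⟫ ≠ 0 := inner_self_ne_zero.2 hne
        have := hlt (((dotm c b + ∑ i, c i * z0 i * 1) / ⟪v, v⟫) • v, fun _ => 1)
          (fun i => one_pos)
        simp only [real_inner_smul_right] at this
        rw [div_mul_cancel₀ _ hvv] at this
        linarith
      have hlt' : ∀ z : Fin m → ℝ, (∀ i, 0 < z i) → - ∑ i, c i * z0 i * z i < dotm c b := by
        intro z hz
        have := hlt (0, z) hz
        simpa using this
      have hnn : ∀ z : Fin m → ℝ, (∀ i, 0 < z i) → 0 ≤ ∑ i, c i * z0 i * z i := by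
        intro z hz
        by_contra hneg
        push Not at hneg
        set S := ∑ i, c i * z0 i * z i with hS
        have h1 := hlt' (fun i => ((|dotm c b| + 1) / (-S)) * z i) (fun i =>
          mul_pos (div_pos (by positivity) (by linarith)) (hz i))
        have h2 : ∑ i, c i * z0 i * (((|dotm c b| + 1) / (-S)) * z i)
            = ((|dotm c b| + 1) / (-S)) * S := by
          rw [hS, Finset.mul_sum]
          exact Finset.sum_congr rfl fun i _ => by ring
        rw [h2] at h1
        have h3 : ((|dotm c b| + 1) / (-S)) * S = -(|dotm c b| + 1) := by
          field_simp [hneg.ne]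
        rw [h3] at h1
        linarith [le_abs_self (dotm c b)]
      have hconf : ∀ i, 0 ≤ c i * z0 i := by
        intro k
        by_contra hneg
        push Not at hneg
        set R := ∑ i, |c i * z0 i| with hR
        have hRn : 0 ≤ R := Finset.sum_nonneg fun i _ => abs_nonneg _
        have h1 := hnn (fun i => if i = k then 1 + (R + 1) / (-(c k * z0 k)) else 1) (fun i => by
          have : 0 < (R + 1) / (-(c k * z0 k)) := div_pos (by linarith) (by linarith)
          split_ifs <;> linarith)
        have h2 : ∑ i, c i * z0 i * (if i = k then 1 + (R + 1) / (-(c k * z0 k)) else 1)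
            = ∑ i, c i * z0 i + c k * z0 k * ((R + 1) / (-(c k * z0 k))) := by
          have : ∀ i, c i * z0 i * (if i = k then 1 + (R + 1) / (-(c k * z0 k)) else 1)
              = c i * z0 i + (if i = k then c i * z0 i * ((R + 1) / (-(c k * z0 k))) else 0) := by
            intro i; split_ifs <;> ring
          simp [this, Finset.sum_add_distrib]
        rw [h2] at h1
        have h3 : c k * z0 k * ((R + 1) / (-(c k * z0 k))) = -(R + 1) := by
          have := hneg.ne
          generalize c k * z0 k = s at *
          field_simp
        have h4 : ∑ i, c i * z0 i ≤ R := Finset.sum_le_sum fun i _ => le_abs_self _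
        linarith
      obtain ⟨h1, h2⟩ := kernel_dot u a b hab x _ c le_rfl hk hconf
      have h0 : 0 ≤ dotm c b := by
        by_contra hneg
        push Not at hneg
        set S := ∑ i, c i * z0 i with hS
        have hSn : 0 ≤ S := Finset.sum_nonneg fun i _ => hconf i
        have h3 := hlt' (fun _ => (- dotm c b) / (S + 1)) (fun i =>
          div_pos (by linarith) (by linarith))
        rw [← Finset.sum_mul, ← hS] at h3
        have h4 : S * (-dotm c b / (S + 1)) ≤ - dotm c b := by
          rw [← mul_div_assoc, div_le_iff₀ (by linarith)]
          nlinarith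
        linarith
      have h3 := h2 (le_antisymm h1 h0)
      have h4 := hlt' (fun _ => 1) (fun _ => one_pos)
      have h5 : ∑ i, c i * z0 i * 1 = 0 := Finset.sum_eq_zero fun i _ => by
        rw [mul_one]; exact h3 i
      rw [h5] at h4
      linarith
  · exfalso
    obtain ⟨g, hg1, hg2⟩ := Submodule.exists_le_ker_of_notMem hbr
    obtain ⟨c, hc⟩ := hfun g
    have hcT : ∀ p : Euc n × (Fin m → ℝ), ⟪∑ i, c i • u i, p.1⟫ - ∑ i, c i * z0 i * p.2 i = 0 := by
      intro p
      rw [← hgT, ← hc]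
      exact hg2 ⟨p, rfl⟩
    have hk : ∑ i, c i • u i = 0 := by
      have := hcT (∑ i, c i • u i, 0)
      simpa using this
    have hz : ∀ i, c i * z0 i = 0 := by
      intro i
      have := hcT (0, Pi.single i 1)
      simpa [Pi.single_apply] using this
    have h1 := (kernel_dot u a b hab x _ c le_rfl hk fun i => (hz i).ge).1
    have h2 := (kernel_dot u a b hab x _ (fun i => - c i) le_rfl (by simp [hk]) (fun i => by
      have := hz i
      simp only [hz0] at this
      rw [neg_mul, this, neg_zero])).1
    have h3 : dotm (fun i => - c i) b = - dotm c b := by simp [dotm]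
    rw [h3] at h2
    apply hg1
    rw [hc]
    exact le_antisymm h1 (neg_nonpos.1 h2)

/-! ### Faces -/

theorem face_point {n m : ℕ} (u : Fin m → Euc n) (a : Fin m → ℝ) (I J K : Set (Fin m))
    (hIJK : IsTripartition I J K) (G : Set (Euc n)) (hG : IsFace (poly u a I J K) G)
    (hne : G.Nonempty) :
    (∃ x ∈ poly u a I J K, activeSet u a {x} = activeSet u a G) ∧
    G = poly u a (activeSet u a G) (J \ activeSet u a G) (K \ activeSet u a G) := by
  classical
  obtain ⟨v, hv⟩ := hG.resolve_left hne.ne_empty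
  have hGP : ∀ x ∈ G, x ∈ poly u a I J K := fun x hx => by rw [hv] at hx; exact hx.1
  have hmem : ∀ i, i ∈ I ∨ i ∈ J ∨ i ∈ K := by
    intro i
    have : i ∈ I ∪ J ∪ K := by rw [hIJK.1]; trivial
    simpa [or_assoc] using this
  have hmid : ∀ x ∈ G, ∀ y ∈ G, (1/2 : ℝ) • x + (1/2 : ℝ) • y ∈ G := by
    intro x hx y hy
    rw [hv] at hx hy ⊢
    obtain ⟨⟨x1, x2, x3⟩, x4⟩ := hx
    obtain ⟨⟨y1, y2, y3⟩, y4⟩ := hy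
    refine ⟨⟨?_, ?_, ?_⟩, ?_⟩
    · intro i hi
      rw [inner_add_right, real_inner_smul_right, real_inner_smul_right]
      linarith [x1 i hi, y1 i hi]
    · intro i hi
      rw [inner_add_right, real_inner_smul_right, real_inner_smul_right]
      linarith [x2 i hi, y2 i hi]
    · intro i hi
      rw [inner_add_right, real_inner_smul_right, real_inner_smul_right]
      linarith [x3 i hi, y3 i hi]
    · intro w hw
      rw [inner_add_right, real_inner_smul_right, real_inner_smul_right]
      linarith [x4 w hw, y4 w hw]
  -- a point with the fewest active constraints
  let act : Euc n → Finset (Fin m) := fun x => Finset.univ.filter (fun i => ⟪u i, x⟫ = a i)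
  obtain ⟨x, hxG, hxmin⟩ : ∃ x ∈ G, ∀ y ∈ G, (act x).card ≤ (act y).card := by
    have := Function.argminOn_mem (fun x => (act x).card) G hne
    exact ⟨_, this, fun y hy => Function.argminOn_le (fun x => (act x).card) G hy⟩
  have hact : activeSet u a {x} = activeSet u a G := by
    ext i
    simp only [activeSet, Set.mem_ofPred_eq, Set.mem_singleton_iff, forall_eq]
    refine ⟨fun hi y hy => ?_, fun h => h x hxG⟩
    by_contra hyi
    have hlt : act ((1/2 : ℝ) • x + (1/2 : ℝ) • y) ⊂ act x := by
      refine (Finset.ssubset_iff_of_subset ?_).2 ⟨i, by simpa [act] using hi, ?_⟩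
      · intro j
        simp only [act, Finset.mem_filter, Finset.mem_univ, true_and, inner_add_right,
          real_inner_smul_right]
        intro hj
        obtain ⟨x1, x2, x3⟩ := hGP x hxG
        obtain ⟨y1, y2, y3⟩ := hGP y hy
        rcases hmem j with h | h | h
        · exact x1 j h
        · linarith [x2 j h, y2 j h]
        · linarith [x3 j h, y3 j h]
      · simp only [act, Finset.mem_filter, Finset.mem_univ, true_and, inner_add_right,
          real_inner_smul_right]
        intro hj
        apply hyi
        linarith
    exact absurd (hxmin _ (hmid x hxG y hy)) (not_le.2 (Finset.card_lt_card hlt))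
  refine ⟨⟨x, hGP x hxG, hact⟩, ?_⟩
  apply Set.Subset.antisymm
  · intro y hy
    obtain ⟨y1, y2, y3⟩ := hGP y hy
    exact ⟨fun i hi => hi y hy, fun j hj => y2 j hj.1, fun k hk => y3 k hk.1⟩
  · intro y hy
    obtain ⟨y1, y2, y3⟩ := hy
    have hyP : y ∈ poly u a I J K := by
      refine ⟨fun i hi => y1 i fun w hw => (hGP w hw).1 i hi, fun j hj => ?_, fun k hk => ?_⟩
      · by_cases h : j ∈ activeSet u a G
        · exact (y1 j h).le
        · exact y2 j ⟨hj, h⟩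
      · by_cases h : k ∈ activeSet u a G
        · exact (y1 k h).ge
        · exact y3 k ⟨hk, h⟩
    obtain ⟨x1, x2, x3⟩ := hGP x hxG
    -- a small step beyond x away from y
    have hev : ∀ i, ∀ᶠ t : ℝ in nhdsWithin 0 (Set.Ioi 0),
        (i ∈ I → ⟪u i, x + t • (x - y)⟫ = a i) ∧ (i ∈ J → ⟪u i, x + t • (x - y)⟫ ≤ a i) ∧
        (i ∈ K → a i ≤ ⟪u i, x + t • (x - y)⟫) := by
      intro i
      by_cases hi : i ∈ activeSet u a G
      · refine Filter.Eventually.of_forall fun t => ?_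
        have : ⟪u i, x + t • (x - y)⟫ = a i := by
          rw [inner_add_right, real_inner_smul_right, inner_sub_right, y1 i hi, hi x hxG]
          ring
        exact ⟨fun _ => this, fun _ => this.le, fun _ => this.ge⟩
      · have hix : ⟪u i, x⟫ ≠ a i := by
          intro h
          apply hi
          rw [← hact]
          simpa [activeSet] using h
        have hiI : i ∉ I := fun h => hix (x1 i h)
        have hcont : Filter.Tendsto (fun t : ℝ => ⟪u i, x + t • (x - y)⟫)
            (nhdsWithin 0 (Set.Ioi 0)) (nhds ⟪u i, x⟫) := by
          have : Continuous (fun t : ℝ => ⟪u i, x + t • (x - y)⟫) := by fun_prop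
          have := this.tendsto 0
          simp only [zero_smul, add_zero] at this
          exact this.mono_left nhdsWithin_le_nhds
        rcases lt_or_gt_of_ne hix with h | h
        · filter_upwards [hcont.eventually_lt_const h] with t ht
          exact ⟨fun h' => absurd h' hiI, fun _ => ht.le, fun h' => absurd (x3 i h') (not_le.2 h)⟩
        · filter_upwards [hcont.eventually_const_lt h] with t ht
          exact ⟨fun h' => absurd h' hiI, fun h' => absurd (x2 i h') (not_le.2 h), fun _ => ht.le⟩
    obtain ⟨t, ht, ht0⟩ := ((Filter.eventually_all.2 hev).and self_mem_nhdsWithin).exists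
    have ht0' : 0 < t := ht0
    have hmemP : x + t • (x - y) ∈ poly u a I J K :=
      ⟨fun i hi => (ht i).1 hi, fun i hi => (ht i).2.1 hi, fun i hi => (ht i).2.2 hi⟩
    have hx4 : ∀ w ∈ poly u a I J K, ⟪v, w⟫ ≤ ⟪v, x⟫ := by
      have := hxG
      rw [hv] at this
      exact this.2
    have hxy : ⟪v, x⟫ ≤ ⟪v, y⟫ := by
      have h1 := hx4 _ hmemP
      rw [inner_add_right, real_inner_smul_right, inner_sub_right] at h1
      have h2 : t * (⟪v, x⟫ - ⟪v, y⟫) ≤ 0 := by linarith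
      by_contra h3
      push Not at h3
      have := mul_pos ht0' (sub_pos.2 h3)
      linarith
    rw [hv]
    exact ⟨hyP, fun w hw => (hx4 w hw).trans hxy⟩

theorem face_of_point {n m : ℕ} (u : Fin m → Euc n) (a : Fin m → ℝ) (I J K : Set (Fin m))
    (hIJK : IsTripartition I J K) (x : Euc n) (hx : x ∈ poly u a I J K) (A : Set (Fin m))
    (hA : activeSet u a {x} = A) :
    IsFace (poly u a I J K) (poly u a A (J \ A) (K \ A)) ∧
    (poly u a A (J \ A) (K \ A)).Nonempty ∧
    activeSet u a (poly u a A (J \ A) (K \ A)) = A := by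
  classical
  have hA' : ∀ i, i ∈ A ↔ ⟪u i, x⟫ = a i := by
    intro i
    rw [← hA]
    simp [activeSet]
  obtain ⟨x1, x2, x3⟩ := hx
  have hxF : x ∈ poly u a A (J \ A) (K \ A) :=
    ⟨fun i hi => (hA' i).1 hi, fun j hj => x2 j hj.1, fun k hk => x3 k hk.1⟩
  refine ⟨Or.inr ?_, ⟨x, hxF⟩, ?_⟩
  · let s : Fin m → ℝ := fun i => if i ∈ A then (if i ∈ J then 1 else if i ∈ K then -1 else 0) else 0
    have hval : ∀ w, ⟪∑ i, s i • u i, w⟫ = ∑ i, s i * ⟪u i, w⟫ := by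
      intro w; simp [sum_inner, real_inner_smul_left]
    have hle : ∀ w ∈ poly u a I J K, ∀ i, s i * ⟪u i, w⟫ ≤ s i * a i := by
      intro w hw i
      simp only [s]
      split_ifs with h1 h2 h3
      · linarith [hw.2.1 i h2]
      · linarith [hw.2.2 i h3]
      · simp
      · simp
    have hxs : ∀ i, s i * ⟪u i, x⟫ = s i * a i := by
      intro i
      by_cases h : i ∈ A
      · rw [(hA' i).1 h]
      · simp [s, h]
    refine ⟨∑ i, s i • u i, ?_⟩
    ext y
    constructor
    · rintro ⟨y1, y2, y3⟩
      refine ⟨⟨fun i hi => y1 i ((hA' i).2 (x1 i hi)), fun j hj => ?_, fun k hk => ?_⟩, ?_⟩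
      · by_cases h : j ∈ A
        · exact (y1 j h).le
        · exact y2 j ⟨hj, h⟩
      · by_cases h : k ∈ A
        · exact (y1 k h).ge
        · exact y3 k ⟨hk, h⟩
      · intro w hw
        rw [hval, hval]
        refine Finset.sum_le_sum fun i _ => (hle w hw i).trans (le_of_eq ?_)
        by_cases h : i ∈ A
        · rw [y1 i h]
        · simp [s, h]
    · rintro ⟨hyP, hy⟩
      have h1 := hy x ⟨x1, x2, x3⟩
      rw [hval, hval, Finset.sum_congr rfl fun i _ => hxs i] at h1
      have h2 := (Finset.sum_eq_sum_iff_of_le fun i _ => hle y hyP i).1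
        (le_antisymm (Finset.sum_le_sum fun i _ => hle y hyP i) h1)
      refine ⟨fun i hi => ?_, fun j hj => hyP.2.1 j hj.1, fun k hk => hyP.2.2 k hk.1⟩
      have h3 := h2 i (Finset.mem_univ i)
      have : i ∈ I ∪ J ∪ K := by rw [hIJK.1]; trivial
      rcases this with (h | h) | h
      · exact hyP.1 i h
      · simpa [s, hi, h] using h3
      · have hJ : i ∉ J := fun h' => Set.disjoint_left.1 hIJK.2.2.2 h' h
        simpa [s, hi, h, hJ] using h3
  · ext i
    exact ⟨fun h => (hA' i).2 (h x hxF), fun h y hy => hy.1 i h⟩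

theorem transfer_point {n m : ℕ} (u : Fin m → Euc n) (a b : Fin m → ℝ)
    (hab : SameOpenFace u a b) (I J K : Set (Fin m)) (x : Euc n) (hx : x ∈ poly u a I J K) :
    ∃ y ∈ poly u b I J K, activeSet u b {y} = activeSet u a {x} := by
  obtain ⟨y, hy⟩ := exists_same_sign u a b hab x
  have h0 : ∀ i, ⟪u i, y⟫ = b i ↔ ⟪u i, x⟫ = a i := by
    intro i
    rw [← sub_eq_zero, ← sign_eq_zero_iff, hy i, sign_eq_zero_iff, sub_eq_zero]
  have h1 : ∀ i, b i < ⟪u i, y⟫ ↔ a i < ⟪u i, x⟫ := by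
    intro i
    rw [← sub_pos, ← sign_eq_one_iff, hy i, sign_eq_one_iff, sub_pos]
  have h2 : ∀ i, ⟪u i, y⟫ < b i ↔ ⟪u i, x⟫ < a i := by
    intro i
    rw [← sub_neg, ← sign_eq_neg_one_iff, hy i, sign_eq_neg_one_iff, sub_neg]
  obtain ⟨x1, x2, x3⟩ := hx
  refine ⟨y, ⟨fun i hi => (h0 i).2 (x1 i hi), fun j hj => ?_, fun k hk => ?_⟩, ?_⟩
  · exact not_lt.1 fun h => not_lt.2 (x2 j hj) ((h1 j).1 h)
  · exact not_lt.1 fun h => not_lt.2 (x3 k hk) ((h2 k).1 h)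
  · ext i
    simpa [activeSet] using h0 i

theorem face_bijection_of_sameOpenFace {n m : ℕ} (hn : 1 ≤ n) (hm : 1 ≤ m)
    (u : Fin m → Euc n) (hu : ∀ i, u i ≠ 0)
    (a b : Fin m → ℝ) (hab : SameOpenFace u a b)
    (I J K : Set (Fin m)) (hIJK : IsTripartition I J K) :
    Set.BijOn
      (fun G : Set (Euc n) =>
        poly u b (activeSet u a G) (J \ activeSet u a G) (K \ activeSet u a G))
      {G | IsFace (poly u a I J K) G ∧ G.Nonempty}
      {G | IsFace (poly u b I J K) G ∧ G.Nonempty} ∧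
    ∀ G : Set (Euc n), IsFace (poly u a I J K) G → G.Nonempty →
      activeSet u b
          (poly u b (activeSet u a G) (J \ activeSet u a G) (K \ activeSet u a G)) =
        activeSet u a G := by
  have hba : SameOpenFace u b a := fun c hc => (hab c hc).symm
  have main : ∀ G : Set (Euc n), IsFace (poly u a I J K) G → G.Nonempty →
      IsFace (poly u b I J K)
        (poly u b (activeSet u a G) (J \ activeSet u a G) (K \ activeSet u a G)) ∧
      (poly u b (activeSet u a G) (J \ activeSet u a G) (K \ activeSet u a G)).Nonempty ∧
      activeSet u b
          (poly u b (activeSet u a G) (J \ activeSet u a G) (K \ activeSet u a G)) =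
        activeSet u a G := by
    intro G hG hne
    obtain ⟨⟨x, hx, hxa⟩, _⟩ := face_point u a I J K hIJK G hG hne
    obtain ⟨y, hy, hya⟩ := transfer_point u a b hab I J K x hx
    exact face_of_point u b I J K hIJK y hy _ (hya.trans hxa)
  refine ⟨⟨?_, ?_, ?_⟩, fun G hG hne => (main G hG hne).2.2⟩
  · rintro G ⟨hG, hne⟩
    exact ⟨(main G hG hne).1, (main G hG hne).2.1⟩
  · rintro G ⟨hG, hne⟩ H ⟨hH, hHne⟩ h
    simp only at h
    have h1 : activeSet u a G = activeSet u a H := by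
      rw [← (main G hG hne).2.2, ← (main H hH hHne).2.2, h]
    rw [(face_point u a I J K hIJK G hG hne).2, (face_point u a I J K hIJK H hH hHne).2, h1]
  · rintro H ⟨hH, hne⟩
    obtain ⟨⟨y, hy, hya⟩, hHe⟩ := face_point u b I J K hIJK H hH hne
    obtain ⟨x, hx, hxa⟩ := transfer_point u b a hba I J K y hy
    obtain ⟨g1, g2, g3⟩ := face_of_point u a I J K hIJK x hx _ (hxa.trans hya)
    refine ⟨_, ⟨g1, g2⟩, ?_⟩
    simp only
    rw [g3]
    exact hHe.symm
end
end
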